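/- Let G be a graph in obs(P1) that is not isomorphic to any of the 33 graphs in O, and suppose G has a cut-vertex x. Then G - x has exactly two connected components, and of the two graphs in C(G,x) one is biconnected and the other is isomorphic to the triangle K3. -/

import Mathlib

open SimpleGraph

/-- `H` is a minor of `G` (branch-set definition): there is a family of connected, nonempty,
pairwise disjoint branch sets in `G`, indexed by the vertices of `H`, such that vertices
adjacent in `H` have an edge of `G` between their branch sets. -/
def IsMinorOf {W V : Type} (H : SimpleGraph W) (G : SimpleGraph V) : Prop :=
  ∃ f : W → Set V,
    (∀ w, (G.induce (f w)).Connected) ∧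
    (∀ ⦃w w' : W⦄, w ≠ w' → Disjoint (f w) (f w')) ∧
    (∀ ⦃w w' : W⦄, H.Adj w w' → ∃ a ∈ f w, ∃ b ∈ f w', G.Adj a b)

/-- A pseudoforest: every connected component contains at most one cycle, i.e. any two
cycles lying in the same connected component have the same edge set. -/
def Pseudoforest {V : Type} (G : SimpleGraph V) : Prop :=
  ∀ ⦃u v : V⦄ (c : G.Walk u u) (c' : G.Walk v v),
    c.IsCycle → c'.IsCycle → G.Reachable u v → ∀ e, e ∈ c.edges ↔ e ∈ c'.edges

/-- An apex-pseudoforest: removing at most one vertex yields a pseudoforest. -/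
def ApexPseudoforest {V : Type} (G : SimpleGraph V) : Prop :=
  ∃ s : Set V, s.Subsingleton ∧ Pseudoforest (G.induce sᶜ)

/-- `G` is a minor-obstruction for the class of apex-pseudoforests: `G` is not an
apex-pseudoforest but every proper minor of `G` is. -/
def ObsApexPseudoforest {V : Type} (G : SimpleGraph V) : Prop :=
  ¬ ApexPseudoforest G ∧
    ∀ (W : Type) [Finite W] (H : SimpleGraph W),
      IsMinorOf H G → IsEmpty (H ≃g G) → ApexPseudoforest H

/-- `G` is `k`-connected: between any two distinct vertices `u ≠ v` there exist `k`
pairwise distinct `(u,v)`-paths, any two of which share no vertices other than `u,v`. -/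
def KConnected {V : Type} (k : ℕ) (G : SimpleGraph V) : Prop :=
  ∀ ⦃u v : V⦄, u ≠ v → ∃ P : Fin k → G.Walk u v,
    Function.Injective P ∧ (∀ i, (P i).IsPath) ∧
      ∀ i j, i ≠ j → ∀ x, x ∈ (P i).support → x ∈ (P j).support → x = u ∨ x = v

/-- The simple graph on `Fin n` with the given list of (0-indexed) edges. -/
def mkGraph (n : ℕ) (E : List (ℕ × ℕ)) : SimpleGraph (Fin n) :=
  SimpleGraph.fromRel fun a b => ((a : ℕ), (b : ℕ)) ∈ E

/-- Obstruction 1: two disjoint diamonds. -/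
def O1 : SimpleGraph (Fin 8) :=
  mkGraph 8 [(0,1),(0,2),(0,3),(1,2),(1,3),(4,5),(4,6),(4,7),(5,6),(5,7)]
/-- Obstruction 2: two disjoint butterflies. -/
def O2 : SimpleGraph (Fin 10) :=
  mkGraph 10 [(0,1),(0,2),(1,2),(0,3),(0,4),(3,4),(5,6),(5,7),(6,7),(5,8),(5,9),(8,9)]
/-- Obstruction 3: a diamond plus a butterfly. -/
def O3 : SimpleGraph (Fin 9) :=
  mkGraph 9 [(0,1),(0,2),(0,3),(1,2),(1,3),(4,5),(4,6),(5,6),(4,7),(4,8),(7,8)]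
def O4 : SimpleGraph (Fin 8) :=
  mkGraph 8 [(0,1),(0,2),(1,2),(2,3),(2,4),(3,4),(3,5),(4,5),(5,6),(5,7),(6,7)]
def O5 : SimpleGraph (Fin 8) :=
  mkGraph 8 [(0,1),(0,2),(1,2),(2,3),(2,4),(3,4),(3,5),(4,6),(5,6),(5,7),(6,7)]
def O6 : SimpleGraph (Fin 8) :=
  mkGraph 8 [(0,1),(0,2),(1,2),(2,3),(2,4),(3,4),(3,5),(4,5),(3,6),(5,6),(4,7),(5,7)]
def O7 : SimpleGraph (Fin 7) :=
  mkGraph 7 [(0,1),(0,6),(1,6),(2,3),(2,4),(2,5),(3,4),(3,5),(4,6),(5,6)]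
def O8 : SimpleGraph (Fin 7) :=
  mkGraph 7 [(0,1),(0,2),(1,2),(2,3),(2,4),(2,5),(3,4),(3,5),(4,5),(4,6),(5,6)]
def O9 : SimpleGraph (Fin 9) :=
  mkGraph 9 [(0,1),(0,2),(1,2),(2,3),(2,4),(3,4),(3,5),(4,5),(2,6),(4,6),(2,7),(3,7),(3,8),(4,8)]
def O10 : SimpleGraph (Fin 9) :=
  mkGraph 9 [(0,1),(1,2),(2,3),(3,0),(0,4),(1,4),(1,5),(2,5),(2,6),(3,6),(0,7),(0,8),(7,8)]
def O11 : SimpleGraph (Fin 9) :=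
  mkGraph 9 [(0,1),(0,2),(1,2),(3,4),(3,5),(4,5),(6,7),(6,8),(7,8),(2,3),(1,8),(4,8)]
def O12 : SimpleGraph (Fin 9) :=
  mkGraph 9 [(0,1),(0,2),(1,2),(3,4),(3,5),(4,5),(6,7),(6,8),(7,8),(2,3),(2,7),(3,6)]
def O13 : SimpleGraph (Fin 9) :=
  mkGraph 9 [(0,1),(0,2),(1,2),(3,4),(3,5),(4,5),(6,7),(6,8),(7,8),(2,3),(2,8),(3,8)]
def O14 : SimpleGraph (Fin 8) :=
  mkGraph 8 [(0,1),(0,2),(1,2),(1,4),(2,3),(2,4),(3,4),(3,5),(4,5),(1,6),(1,7),(6,7)]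
def O15 : SimpleGraph (Fin 9) :=
  mkGraph 9 [(0,1),(0,2),(1,2),(2,3),(2,4),(3,4),(4,5),(4,6),(5,6),(6,7),(6,8),(7,8),(2,6)]
def O16 : SimpleGraph (Fin 6) :=
  mkGraph 6 [(0,2),(0,3),(0,4),(0,5),(1,2),(1,3),(1,4),(1,5),(2,3),(4,5)]
def O17 : SimpleGraph (Fin 6) :=
  mkGraph 6 [(0,1),(1,3),(3,2),(2,0),(4,0),(4,1),(4,2),(4,3),(5,0),(5,1)]
def O18 : SimpleGraph (Fin 8) :=
  mkGraph 8 [(0,1),(1,2),(2,3),(3,0),(4,0),(4,1),(5,1),(5,2),(6,2),(6,3),(7,3),(7,0)]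
def O19 : SimpleGraph (Fin 7) :=
  mkGraph 7 [(0,2),(0,3),(1,2),(1,3),(2,3),(0,4),(4,1),(5,0),(5,4),(6,4),(6,1)]
def O20 : SimpleGraph (Fin 6) :=
  mkGraph 6 [(1,2),(1,4),(1,5),(2,4),(2,5),(4,5),(0,1),(0,4),(2,3),(3,5)]
def O21 : SimpleGraph (Fin 7) :=
  mkGraph 7 [(0,1),(0,3),(0,4),(1,3),(1,4),(3,5),(4,5),(1,2),(2,4),(3,6),(5,6)]
def O22 : SimpleGraph (Fin 8) :=
  mkGraph 8 [(0,1),(0,3),(1,4),(3,4),(1,2),(2,4),(7,0),(7,3),(5,7),(5,0),(6,7),(6,3)]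
def O23 : SimpleGraph (Fin 7) :=
  mkGraph 7 [(2,3),(2,4),(2,6),(3,4),(3,6),(4,6),(5,3),(5,4),(0,2),(0,3),(1,2),(1,4)]
def O24 : SimpleGraph (Fin 7) :=
  mkGraph 7 [(0,1),(0,2),(1,2),(1,3),(2,4),(3,5),(3,6),(4,5),(4,6),(5,6)]
def O25 : SimpleGraph (Fin 8) :=
  mkGraph 8 [(0,1),(0,3),(1,3),(1,2),(1,5),(2,5),(1,7),(2,7),(3,4),(4,5),(3,5),(3,6),(5,6)]
def O26 : SimpleGraph (Fin 9) :=
  mkGraph 9 [(2,3),(2,4),(3,4),(5,3),(5,4),(8,3),(8,4),(0,2),(0,3),(7,2),(7,3),(1,2),(1,4),(6,2),(6,4)]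
def O27 : SimpleGraph (Fin 8) :=
  mkGraph 8 [(0,2),(1,2),(0,3),(2,3),(1,6),(2,6),(3,4),(6,7),(4,5),(5,7),(3,7),(4,7)]
def O28 : SimpleGraph (Fin 7) :=
  mkGraph 7 [(0,1),(0,2),(1,2),(1,3),(1,5),(3,5),(3,4),(3,6),(4,6),(2,5),(5,6)]
def O29 : SimpleGraph (Fin 9) :=
  mkGraph 9 [(0,1),(0,2),(1,2),(3,4),(3,5),(4,5),(6,7),(6,8),(7,8),(2,3),(1,7),(4,6)]
def O30 : SimpleGraph (Fin 8) :=
  mkGraph 8 [(0,1),(0,2),(1,2),(3,4),(3,5),(4,5),(6,7),(1,6),(4,6),(0,7),(5,7)]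
/-- Obstruction 31: the prism. -/
def O31 : SimpleGraph (Fin 6) :=
  mkGraph 6 [(0,1),(0,2),(1,2),(3,4),(3,5),(4,5),(0,3),(1,4),(2,5)]
/-- Obstruction 32: `K₃,₃`. -/
def O32 : SimpleGraph (Fin 6) :=
  mkGraph 6 [(0,3),(0,4),(0,5),(1,3),(1,4),(1,5),(2,3),(2,4),(2,5)]
/-- Obstruction 33: `K₅` minus one edge. -/
def O33 : SimpleGraph (Fin 5) :=
  mkGraph 5 [(0,1),(0,2),(0,3),(0,4),(1,2),(1,3),(1,4),(2,3),(2,4)]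

/-- The list `O` of the 33 obstructions. -/
def OList : List ((n : ℕ) × SimpleGraph (Fin n)) :=
  [⟨8, O1⟩, ⟨10, O2⟩, ⟨9, O3⟩, ⟨8, O4⟩, ⟨8, O5⟩, ⟨8, O6⟩, ⟨7, O7⟩, ⟨7, O8⟩, ⟨9, O9⟩,
   ⟨9, O10⟩, ⟨9, O11⟩, ⟨9, O12⟩, ⟨9, O13⟩, ⟨8, O14⟩, ⟨9, O15⟩, ⟨6, O16⟩, ⟨6, O17⟩,
   ⟨8, O18⟩, ⟨7, O19⟩, ⟨6, O20⟩, ⟨7, O21⟩, ⟨8, O22⟩, ⟨7, O23⟩, ⟨7, O24⟩, ⟨8, O25⟩,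
   ⟨9, O26⟩, ⟨8, O27⟩, ⟨7, O28⟩, ⟨9, O29⟩, ⟨8, O30⟩, ⟨6, O31⟩, ⟨6, O32⟩, ⟨5, O33⟩]

/-- `G` is isomorphic to one of the 33 graphs in `O`. -/
def InO {V : Type} (G : SimpleGraph V) : Prop :=
  ∃ H ∈ OList, Nonempty (G ≃g H.2)

/-- A cut-vertex: a vertex whose deletion increases the number of connected components. -/
def CutVertex {V : Type} (G : SimpleGraph V) (x : V) : Prop :=
  Nat.card G.ConnectedComponent <
    Nat.card (G.induce ({x}ᶜ : Set V)).ConnectedComponent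

section ConnectedSets

variable {V : Type} [DecidableEq V] {G : SimpleGraph V}

/-- Two vertex sets are joined by an edge. -/
def Touch (G : SimpleGraph V) (A B : Finset V) : Prop :=
  ∃ a ∈ A, ∃ b ∈ B, G.Adj a b

/-- A nonempty vertex set that induces a connected subgraph, phrased through cuts. -/
def Conn (G : SimpleGraph V) (S : Finset V) : Prop :=
  S.Nonempty ∧ ∀ P Q : Finset V, P.Nonempty → Q.Nonempty → Disjoint P Q → P ∪ Q = S → Touch G P Q

/-- `Z` is the vertex set of a connected component of the subgraph induced by `S`. -/
def IsComp (G : SimpleGraph V) (S Z : Finset V) : Prop :=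
  Z ⊆ S ∧ Conn G Z ∧ ¬ Touch G Z (S \ Z)

omit [DecidableEq V] in
theorem Touch.symm {A B : Finset V} (h : Touch G A B) : Touch G B A := by
  obtain ⟨a, ha, b, hb, hab⟩ := h
  exact ⟨b, hb, a, ha, hab.symm⟩

omit [DecidableEq V] in
theorem Touch.mono {A B A' B' : Finset V} (h : Touch G A B) (hA : A ⊆ A') (hB : B ⊆ B') :
    Touch G A' B' := by
  obtain ⟨a, ha, b, hb, hab⟩ := h
  exact ⟨a, hA ha, b, hB hb, hab⟩

theorem conn_singleton (v : V) : Conn G {v} := by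
  refine ⟨by simp, fun P Q hP hQ hd hu => ?_⟩
  obtain ⟨p, hp⟩ := hP
  obtain ⟨q, hq⟩ := hQ
  have h1 : p ∈ ({v} : Finset V) := hu ▸ Finset.mem_union_left _ hp
  have h2 : q ∈ ({v} : Finset V) := hu ▸ Finset.mem_union_right _ hq
  rw [Finset.mem_singleton] at h1 h2
  subst h1 h2
  exact absurd hq (Finset.disjoint_left.1 hd hp)

theorem Conn.touch {S P : Finset V} (h : Conn G S) (hPS : P ⊆ S) (hP : P.Nonempty)
    (hne : P ≠ S) : Touch G P (S \ P) := by
  refine h.2 P (S \ P) hP ?_ Finset.disjoint_sdiff (Finset.union_sdiff_of_subset hPS)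
  rw [Finset.sdiff_nonempty]
  exact fun hs => hne (Finset.Subset.antisymm hPS hs)

/-- A connected subset of a union of two sets that do not touch lies in one of them. -/
theorem Conn.subset_or {A P Q : Finset V} (hA : Conn G A) (hAPQ : A ⊆ P ∪ Q)
    (ht : ¬ Touch G P Q) : A ⊆ P ∨ A ⊆ Q := by
  by_contra! hc
  have h1 : (A \ Q).Nonempty := by rw [Finset.sdiff_nonempty]; exact hc.2
  obtain ⟨p, hp, hpP⟩ := Finset.not_subset.1 hc.1
  have h := hA.touch (P := A \ Q) Finset.sdiff_subset h1 (by
    intro he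
    have : p ∈ A \ Q := by rw [he]; exact hp
    have := hAPQ hp
    simp_all)
  refine ht (h.mono ?_ ?_)
  · intro a ha
    have := hAPQ (Finset.mem_sdiff.1 ha).1
    simp_all
  · intro a ha
    simp_all

theorem Conn.union {A B : Finset V} (hA : Conn G A) (hB : Conn G B)
    (h : Touch G A B ∨ ¬ Disjoint A B) : Conn G (A ∪ B) := by
  refine ⟨hA.1.mono Finset.subset_union_left, fun P Q hP hQ hd hu => ?_⟩
  by_contra ht
  have ha := hA.subset_or (P := P) (Q := Q) (hu ▸ Finset.subset_union_left) ht
  have hb := hB.subset_or (P := P) (Q := Q) (hu ▸ Finset.subset_union_right) ht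
  obtain ⟨p, hp⟩ := hP
  obtain ⟨q, hq⟩ := hQ
  have key : ∀ X Y : Finset V, Disjoint X Y → ¬ Touch G X Y → A ⊆ X → B ⊆ Y → False := by
    intro X Y hXY hXYt hAX hBY
    rcases h with h | h
    · exact hXYt (h.mono hAX hBY)
    · exact h (hXY.mono hAX hBY)
  have hp' : p ∈ A ∪ B := hu ▸ Finset.mem_union_left _ hp
  have hq' : q ∈ A ∪ B := hu ▸ Finset.mem_union_right _ hq
  rw [Finset.disjoint_left] at hd
  rcases ha with ha | ha <;> rcases hb with hb | hb
  · exact hd (Finset.union_subset ha hb hq') hq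
  · exact key P Q (Finset.disjoint_left.2 hd) ht ha hb
  · exact key Q P (Finset.disjoint_left.2 hd).symm (fun h' => ht h'.symm) ha hb
  · exact hd hp (Finset.union_subset ha hb hp')

theorem Conn.insert_vertex {A : Finset V} {v : V} (hA : Conn G A) (h : Touch G {v} A) :
    Conn G (insert v A) := by
  rw [Finset.insert_eq]
  exact (conn_singleton v).union hA (Or.inl h)

theorem IsComp.subset_of_conn {S Z A : Finset V} (hZ : IsComp G S Z) (hA : Conn G A)
    (hAS : A ⊆ S) (h : ¬ Disjoint A Z) : A ⊆ Z := by
  rcases hA.subset_or (P := Z) (Q := S \ Z)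
    (by rwa [Finset.union_sdiff_of_subset hZ.1]) hZ.2.2 with h' | h'
  · exact h'
  · exact absurd (Finset.sdiff_disjoint.mono_left h') h

theorem exists_isComp {S A : Finset V} (hA : Conn G A) (hAS : A ⊆ S) :
    ∃ Z, IsComp G S Z ∧ A ⊆ Z := by
  classical
  obtain ⟨Z, hZ, hmax⟩ := (S.powerset.filter fun Z => Conn G Z ∧ A ⊆ Z).exists_max_image
    Finset.card ⟨A, by simp [hA, hAS]⟩
  simp only [Finset.mem_filter, Finset.mem_powerset, and_imp] at hZ hmax
  refine ⟨Z, ⟨hZ.1, hZ.2.1, ?_⟩, hZ.2.2⟩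
  rintro ⟨a, ha, b, hb, hab⟩
  rw [Finset.mem_sdiff] at hb
  have := hmax (insert b Z) (Finset.insert_subset hb.1 hZ.1)
    (hZ.2.1.insert_vertex ⟨b, by simp, a, ha, hab.symm⟩) (hZ.2.2.trans (Finset.subset_insert _ _))
  rw [Finset.card_insert_of_notMem hb.2] at this
  omega

/-- Removing some components of `T \ A` from a connected set `T` keeps it connected. -/
theorem Conn.sdiff {T A U : Finset V} (hT : Conn G T) (hA : Conn G A) (hAT : A ⊆ T)
    (hU : U ⊆ T \ A) (h : ¬ Touch G U ((T \ A) \ U)) : Conn G (T \ U) := by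
  have hAU : A ⊆ T \ U := fun a ha => by
    have := @hU a
    have := hAT ha
    simp_all
  refine ⟨hA.1.mono hAU, fun P Q hP hQ hd hu => ?_⟩
  by_contra ht
  have key : ∀ X Y : Finset V, Y.Nonempty → Disjoint X Y → X ∪ Y = T \ U → ¬ Touch G X Y →
      A ⊆ X → False := by
    intro X Y hY hXY hXYu hXYt hAX
    have hYT : Y ⊆ T \ U := hXYu ▸ Finset.subset_union_right
    have htY := hT.touch (P := Y) (hYT.trans Finset.sdiff_subset) hY (by
      rintro rfl
      obtain ⟨a, ha⟩ := hA.1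
      exact Finset.disjoint_left.1 hXY (hAX ha) (hAT ha))
    obtain ⟨a, ha, b, hb, hab⟩ := htY
    rw [Finset.mem_sdiff] at hb
    by_cases hbU : b ∈ U
    · refine h ⟨b, hbU, a, ?_, hab.symm⟩
      have h1 := hYT ha
      rw [Finset.mem_sdiff] at h1
      simp only [Finset.mem_sdiff]
      exact ⟨⟨h1.1, fun haA => Finset.disjoint_left.1 hXY (hAX haA) ha⟩, h1.2⟩
    · have h1 : b ∈ X ∪ Y := by rw [hXYu]; simp [hb, hbU]
      rw [Finset.mem_union] at h1
      exact hXYt ⟨b, h1.resolve_right hb.2, a, ha, hab.symm⟩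
  rcases hA.subset_or (P := P) (Q := Q) (hu ▸ hAU) ht with h' | h'
  · exact key P Q hQ hd hu ht h'
  · exact key Q P hP hd.symm (by rwa [Finset.union_comm]) (fun h => ht h.symm) h'

theorem Conn.sdiff_comp {T A U : Finset V} (hT : Conn G T) (hA : Conn G A) (hAT : A ⊆ T)
    (hU : IsComp G (T \ A) U) : Conn G (T \ U) :=
  hT.sdiff hA hAT hU.1 hU.2.2

/-- A connected set can be split into two connected parts separating two given vertices. -/
theorem Conn.split {S : Finset V} (hS : Conn G S) {p q : V} (hp : p ∈ S) (hq : q ∈ S)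
    (hpq : p ≠ q) : ∃ A B, Disjoint A B ∧ A ∪ B = S ∧ Conn G A ∧ Conn G B ∧ p ∈ A ∧ q ∈ B ∧
      Touch G A B := by
  obtain ⟨B, hB, hqB⟩ := exists_isComp (G := G) (S := S \ {p}) (conn_singleton q)
    (by simp [hq, hpq.symm])
  have hBS : B ⊆ S := hB.1.trans Finset.sdiff_subset
  have hpB : p ∉ B := fun h => by simpa using hB.1 h
  refine ⟨S \ B, B, Finset.sdiff_disjoint, Finset.sdiff_union_of_subset hBS,
    hS.sdiff_comp (conn_singleton p) (by simpa using hp) hB, hB.2.1, by simp [hp, hpB],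
    by simpa using hqB, ?_⟩
  exact (hS.touch hBS hB.2.1.1 (by rintro rfl; exact hpB hp)).symm

/-- The interior of a path inside a connected set between two nonadjacent vertices. -/
theorem Conn.exists_between {K : Finset V} (hK : Conn G K) {u w : V} (hu : u ∈ K) (hw : w ∈ K)
    (huw : u ≠ w) (hadj : ¬ G.Adj u w) :
    ∃ A ⊆ K, u ∉ A ∧ w ∉ A ∧ Conn G A ∧ Touch G {u} A ∧ Touch G {w} A := by
  obtain ⟨Z, hZ, hwZ⟩ := exists_isComp (G := G) (S := K \ {u}) (conn_singleton w)
    (by simp [hw, huw.symm])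
  have hZK : Z ⊆ K := hZ.1.trans Finset.sdiff_subset
  have huZ : u ∉ Z := fun h => by simpa using hZ.1 h
  have hwZ' : w ∈ Z := by simpa using hwZ
  obtain ⟨p, hp, b, hb, hpb⟩ := hK.touch hZK hZ.2.1.1 (by rintro rfl; exact huZ hu)
  have hbu : b = u := by
    by_contra hne
    exact hZ.2.2 ⟨p, hp, b, by simp_all, hpb⟩
  subst hbu
  have hpw : p ≠ w := by rintro rfl; exact hadj hpb.symm
  obtain ⟨A, hA, hpA⟩ := exists_isComp (G := G) (S := Z \ {w}) (conn_singleton p)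
    (by simp [hp, hpw])
  have hAZ : A ⊆ Z := hA.1.trans Finset.sdiff_subset
  have hwA : w ∉ A := fun h => by simpa using hA.1 h
  refine ⟨A, hAZ.trans hZK, fun h => huZ (hAZ h), hwA, hA.2.1,
    ⟨b, by simp, p, by simpa using hpA, hpb.symm⟩, ?_⟩
  obtain ⟨s, hs, t, ht, hst⟩ := hZ.2.1.touch hAZ hA.2.1.1 (by rintro rfl; exact hwA hwZ')
  have htw : t = w := by
    by_contra hne
    exact hA.2.2 ⟨s, hs, t, by simp_all, hst⟩
  subst htw
  exact ⟨t, by simp, s, hs, hst.symm⟩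

theorem Conn.induce_connected {S : Finset V} (hS : Conn G S) : (G.induce (S : Set V)).Connected := by
  classical
  have : Nonempty (S : Set V) := by
    obtain ⟨s, hs⟩ := hS.1
    exact ⟨⟨s, hs⟩⟩
  refine ⟨fun u v => ?_⟩
  by_contra hr
  obtain ⟨a, ha, b, hb, hab⟩ := hS.touch
    (P := S.filter fun w => ∃ h : w ∈ S, (G.induce (S : Set V)).Reachable u ⟨w, h⟩)
    (Finset.filter_subset _ _) ⟨u.1, by simp⟩ (by
      intro he
      have := (Finset.ext_iff.1 he v.1).2 v.2
      rw [Finset.mem_filter] at this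
      exact hr this.2.2)
  simp only [Finset.mem_filter, Finset.mem_sdiff, not_and, not_exists] at ha hb
  obtain ⟨haS, _, har⟩ := ha
  refine hb.2 hb.1 hb.1 (har.trans ?_)
  exact SimpleGraph.Adj.reachable (by simpa using hab)

end ConnectedSets

section Counting

variable {V : Type} {G : SimpleGraph V}

open Classical in
/-- The number of pairs in `A × B` that are edges. -/
noncomputable def crossCount (G : SimpleGraph V) (A B : Finset V) : ℕ :=
  ∑ a ∈ A, ∑ b ∈ B, if G.Adj a b then 1 else 0

/-- The number of edges induced by `S`. -/
noncomputable def edgeCount (G : SimpleGraph V) (S : Finset V) : ℕ :=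
  crossCount G S S / 2

theorem crossCount_comm (A B : Finset V) : crossCount G A B = crossCount G B A := by
  classical
  unfold crossCount
  rw [Finset.sum_comm]
  exact Finset.sum_congr rfl fun a _ => Finset.sum_congr rfl fun b _ =>
    if_congr (G.adj_comm _ _) rfl rfl

theorem crossCount_pos {A B : Finset V} : 0 < crossCount G A B ↔ Touch G A B := by
  classical
  unfold crossCount Touch
  simp only [Finset.sum_pos_iff]
  refine exists_congr fun a => and_congr_right fun _ => exists_congr fun b =>
    and_congr_right fun _ => ?_
  split_ifs with h <;> simp [h]

theorem crossCount_eq_zero {A B : Finset V} : crossCount G A B = 0 ↔ ¬ Touch G A B := by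
  rw [← crossCount_pos]
  omega

variable [DecidableEq V]

theorem crossCount_union_left {A B C : Finset V} (h : Disjoint A B) :
    crossCount G (A ∪ B) C = crossCount G A C + crossCount G B C :=
  Finset.sum_union h

theorem crossCount_union_right {A B C : Finset V} (h : Disjoint A B) :
    crossCount G C (A ∪ B) = crossCount G C A + crossCount G C B := by
  rw [crossCount_comm, crossCount_union_left h, crossCount_comm A, crossCount_comm B]

omit [DecidableEq V] in
theorem crossCount_singleton_self (v : V) : crossCount G {v} {v} = 0 := by
  simp [crossCount]

theorem crossCount_mono_right {A B C : Finset V} (h : B ⊆ C) :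
    crossCount G A B ≤ crossCount G A C := by
  rw [← Finset.union_sdiff_of_subset h, crossCount_union_right Finset.disjoint_sdiff]
  omega

theorem two_mul_edgeCount (S : Finset V) : 2 * edgeCount G S = crossCount G S S := by
  suffices h : Even (crossCount G S S) from Nat.mul_div_cancel' h.two_dvd
  induction S using Finset.induction with
  | empty => simp [crossCount]
  | insert a S ha ih =>
    have hd : Disjoint {a} S := by simpa using ha
    rw [Finset.insert_eq, crossCount_union_left hd, crossCount_union_right hd,
      crossCount_union_right hd, crossCount_singleton_self, crossCount_comm S {a}]
    obtain ⟨k, hk⟩ := ih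
    exact ⟨crossCount G {a} S + k, by omega⟩

theorem edgeCount_union {A B : Finset V} (h : Disjoint A B) :
    edgeCount G (A ∪ B) = edgeCount G A + edgeCount G B + crossCount G A B := by
  have h0 := two_mul_edgeCount (G := G) (A ∪ B)
  have h1 := two_mul_edgeCount (G := G) A
  have h2 := two_mul_edgeCount (G := G) B
  rw [crossCount_union_left h, crossCount_union_right h, crossCount_union_right h,
    crossCount_comm B A] at h0
  omega

theorem edgeCount_sdiff_add {A B : Finset V} (h : A ⊆ B) :
    edgeCount G B = edgeCount G A + edgeCount G (B \ A) + crossCount G A (B \ A) := by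
  rw [← edgeCount_union Finset.disjoint_sdiff, Finset.union_sdiff_of_subset h]

omit [DecidableEq V] in
theorem edgeCount_singleton (v : V) : edgeCount G {v} = 0 := by
  simp [edgeCount, crossCount_singleton_self]

omit [DecidableEq V] in
theorem edgeCount_empty : edgeCount G ∅ = 0 := by
  simp [edgeCount, crossCount]

theorem edgeCount_insert {v : V} {S : Finset V} (h : v ∉ S) :
    edgeCount G (insert v S) = edgeCount G S + crossCount G {v} S := by
  rw [Finset.insert_eq, edgeCount_union (by simpa using h), edgeCount_singleton]
  omega

omit [DecidableEq V] in
theorem crossCount_singleton_left (v : V) (S : Finset V) [DecidablePred (G.Adj v)] :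
    crossCount G {v} S = (S.filter (G.Adj v)).card := by
  simp only [crossCount, Finset.sum_singleton, Finset.card_filter]
  exact Finset.sum_congr rfl fun _ _ => by congr

omit [DecidableEq V] in
theorem two_le_crossCount {v : V} {S : Finset V} (h : 2 ≤ crossCount G {v} S) :
    ∃ p ∈ S, ∃ q ∈ S, p ≠ q ∧ G.Adj v p ∧ G.Adj v q := by
  classical
  rw [crossCount_singleton_left] at h
  obtain ⟨p, hp, q, hq, hpq⟩ := Finset.one_lt_card.1 h
  rw [Finset.mem_filter] at hp hq
  exact ⟨p, hp.1, q, hq.1, hpq, hp.2, hq.2⟩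

/-- In a connected set the excess of edges over vertices is monotone. -/
theorem Conn.edgeCount_mono {R : Finset V} (hR : Conn G R) {T : Finset V} (hT : T.Nonempty)
    (hTR : T ⊆ R) : edgeCount G T + R.card ≤ edgeCount G R + T.card := by
  induction hn : (R \ T).card generalizing T with
  | zero =>
    rw [Finset.card_eq_zero, Finset.sdiff_eq_empty_iff_subset] at hn
    rw [Finset.Subset.antisymm hTR hn]
  | succ n ih =>
    obtain ⟨a, ha, b, hb, hab⟩ := hR.touch hTR hT (by rintro rfl; simp at hn)
    rw [Finset.mem_sdiff] at hb
    have h1 : 0 < crossCount G {b} T := crossCount_pos.2 ⟨b, by simp, a, ha, hab.symm⟩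
    have h2 := ih (T := insert b T) (by simp) (Finset.insert_subset hb.1 hTR) (by
      rw [Finset.sdiff_insert, Finset.card_erase_of_mem (by simp [hb]), hn]; rfl)
    rw [edgeCount_insert hb.2, Finset.card_insert_of_notMem hb.2] at h2
    omega

theorem Conn.card_le {R : Finset V} (hR : Conn G R) : R.card ≤ edgeCount G R + 1 := by
  obtain ⟨r, hr⟩ := hR.1
  have := hR.edgeCount_mono (T := {r}) (by simp) (by simpa using hr)
  rw [edgeCount_singleton, Finset.card_singleton] at this
  omega

/-- If a function that is additive over components exceeds the cardinality, then it does so on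
some component. -/
theorem exists_isComp_card_lt (f : Finset V → ℕ) (h0 : f ∅ = 0)
    (hf : ∀ A B, Disjoint A B → ¬ Touch G A B → f (A ∪ B) = f A + f B) {L : Finset V}
    (h : L.card < f L) : ∃ S, IsComp G L S ∧ S.card < f S := by
  induction hn : L.card using Nat.strong_induction_on generalizing L with
  | _ n ih =>
    obtain ⟨p, hp⟩ : L.Nonempty := by
      rw [Finset.nonempty_iff_ne_empty]
      rintro rfl
      simp [h0] at h
    obtain ⟨S, hS, -⟩ := exists_isComp (G := G) (S := L) (conn_singleton p) (by simpa using hp)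
    by_cases hSf : S.card < f S
    · exact ⟨S, hS, hSf⟩
    have h1 := hf S (L \ S) Finset.disjoint_sdiff hS.2.2
    rw [Finset.union_sdiff_of_subset hS.1] at h1
    have h2 := Finset.card_sdiff_add_card_eq_card hS.1
    have h3 := hS.2.1.1.card_pos
    obtain ⟨S', hS', hSf'⟩ := ih (L \ S).card (by omega) (by omega) rfl
    refine ⟨S', ⟨hS'.1.trans Finset.sdiff_subset, hS'.2.1, ?_⟩, hSf'⟩
    rintro ⟨a, ha, b, hb, hab⟩
    rw [Finset.mem_sdiff] at hb
    by_cases hbS : b ∈ S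
    · exact hS.2.2 ⟨b, hbS, a, hS'.1 ha, hab.symm⟩
    · exact hS'.2.2 ⟨a, ha, b, by simp [hb, hbS], hab⟩

theorem edgeCount_union_of_not_touch {A B : Finset V} (h : Disjoint A B) (ht : ¬ Touch G A B) :
    edgeCount G (A ∪ B) = edgeCount G A + edgeCount G B := by
  rw [edgeCount_union h, crossCount_eq_zero.2 ht, add_zero]

end Counting

section Sparsity

variable {V : Type} {G : SimpleGraph V}

theorem edgeCount_eq_card_edgeSet (S : Finset V) :
    edgeCount G S = Nat.card (G.induce (S : Set V)).edgeSet := by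
  classical
  have h1 := (G.induce (S : Set V)).sum_degrees_eq_twice_card_edges
  have h2 := two_mul_edgeCount (G := G) S
  rw [Nat.card_eq_fintype_card, SimpleGraph.card_edgeSet]
  have h3 : crossCount G S S = ∑ v : (S : Set V), (G.induce (S : Set V)).degree v := by
    rw [crossCount, ← Finset.sum_coe_sort S]
    refine Finset.sum_congr rfl fun v _ => ?_
    rw [← Finset.sum_coe_sort S, ← SimpleGraph.card_neighborFinset_eq_degree,
      ← Finset.card_filter]
    congr 1
    ext w
    simp
  omega

theorem exists_isCycle_of_card_le [Finite V] (hG : G.Connected)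
    (h : Nat.card V ≤ Nat.card G.edgeSet) : ∃ (u : V) (c : G.Walk u u), c.IsCycle := by
  by_contra! hc
  have : G.IsTree := ⟨hG, fun u c => hc u c⟩
  have := (isTree_iff_connected_and_card.1 this).2
  omega

theorem card_le_of_isCycle [Finite V] (hG : G.Connected) {u : V} {c : G.Walk u u}
    (hc : c.IsCycle) : Nat.card V ≤ Nat.card G.edgeSet := by
  by_contra! h
  have h1 := hG.card_vert_le_card_edgeSet_add_one
  exact (isTree_iff_connected_and_card.2 ⟨hG, by omega⟩).isAcyclic c hc

theorem connected_deleteEdges_of_mem_cycle (hG : G.Connected) {u : V} {c : G.Walk u u}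
    (hc : c.IsCycle) {e : Sym2 V} (he : e ∈ c.edges) : (G.deleteEdges {e}).Connected := by
  induction e with
  | _ x y => exact hG.connected_delete_edge_of_not_isBridge fun hb =>
      hb.notMem_edges_of_isCycle hc he

theorem card_edgeSet_deleteEdges [Finite V] {e : Sym2 V} (he : e ∈ G.edgeSet) :
    Nat.card (G.deleteEdges {e}).edgeSet + 1 = Nat.card G.edgeSet := by
  rw [edgeSet_deleteEdges, Nat.card_coe_set_eq, Nat.card_coe_set_eq,
    Set.ncard_sdiff_singleton_add_one he (Set.toFinite _)]

theorem pseudoforest_iff_edgeCount [Finite V] :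
    Pseudoforest G ↔ ∀ T : Finset V, edgeCount G T ≤ T.card := by
  classical
  constructor
  · intro hG T
    by_contra! hT
    obtain ⟨S, hS, hcard⟩ := exists_isComp_card_lt (G := G) (edgeCount G) edgeCount_empty
      (fun A B => edgeCount_union_of_not_touch) hT
    have hconn := hS.2.1.induce_connected
    have hSc : Nat.card (S : Set V) = S.card := by simp
    rw [edgeCount_eq_card_edgeSet, ← hSc] at hcard
    obtain ⟨u, c, hc⟩ := exists_isCycle_of_card_le hconn hcard.le
    obtain ⟨e, he⟩ := List.exists_mem_of_ne_nil c.edges (by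
      simpa [SimpleGraph.Walk.edges_eq_nil] using hc.ne_nil)
    have hdel := card_edgeSet_deleteEdges (c.edges_subset_edgeSet he)
    obtain ⟨w, c', hc'⟩ := exists_isCycle_of_card_le
      (connected_deleteEdges_of_mem_cycle hconn hc he) (by omega)
    have hle := (G.induce (S : Set V)).deleteEdges_le {e}
    let f := (Embedding.induce (G := G) (S : Set V)).toHom
    have hf : Function.Injective f := (Embedding.induce (G := G) (S : Set V)).injective
    have hm : (c'.mapLe hle).edges = c'.edges := Walk.edges_mapLe_eq_edges ..
    have key := hG (c.map f) ((c'.mapLe hle).map f) (hc.map hf) ((hc'.mapLe hle).map hf)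
      ((hconn.preconnected u w).map f) (e.map f)
    simp only [Walk.edges_map, hm,
      List.mem_map_of_injective (Sym2.map.injective hf)] at key
    have := c'.edges_subset_edgeSet (key.1 he)
    simp at this
  · intro hG
    suffices key : ∀ ⦃u v : V⦄ (c : G.Walk u u) (c' : G.Walk v v), c.IsCycle → c'.IsCycle →
        G.Reachable u v → ∀ e, e ∈ c.edges → e ∈ c'.edges from
      fun u v c c' hc hc' hr e => ⟨key c c' hc hc' hr e, key c' c hc' hc hr.symm e⟩
    intro u v c c' hc hc' hr e he
    by_contra he'
    have hS : ∀ w, w ∈ (Set.toFinite {w | G.Reachable u w}).toFinset ↔ G.Reachable u w := by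
      simp
    generalize (Set.toFinite {w | G.Reachable u w}).toFinset = S at hS
    have hcS : ∀ w ∈ c.support, w ∈ (S : Set V) := fun w hw => by
      simpa [hS] using ⟨c.takeUntil w hw⟩
    have hcS' : ∀ w ∈ c'.support, w ∈ (S : Set V) := fun w hw => by
      simpa [hS] using hr.trans ⟨c'.takeUntil w hw⟩
    have hconn : (G.induce (S : Set V)).Connected := by
      have : (S : Set V) = (G.connectedComponentMk u).supp := by
        ext w
        simp [hS, reachable_comm]
      rw [this]
      exact (G.connectedComponentMk u).connected_toSimpleGraph
    have hd : (c.induce S hcS).IsCycle := .of_map (f := (Embedding.induce (S : Set V)).toHom) (by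
      rwa [Walk.map_induce])
    have hd' : (c'.induce S hcS').IsCycle :=
      .of_map (f := (Embedding.induce (S : Set V)).toHom) (by rwa [Walk.map_induce])
    have hme : e ∈ ((c.induce S hcS).map (Embedding.induce (S : Set V)).toHom).edges := by
      rwa [Walk.map_induce]
    rw [Walk.edges_map, List.mem_map] at hme
    obtain ⟨e₀, he₀, rfl⟩ := hme
    have hne : e₀ ∉ (c'.induce S hcS').edges := fun h => he' (by
      have hm : e₀.map (Embedding.induce (G := G) (S : Set V)).toHom ∈ ((c'.induce S hcS').map (Embedding.induce (S : Set V)).toHom).edges := by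
        rw [Walk.edges_map]
        exact List.mem_map_of_mem h
      rwa [Walk.map_induce] at hm)
    have h1 := card_edgeSet_deleteEdges (Walk.edges_subset_edgeSet _ he₀)
    have h2 := card_le_of_isCycle (connected_deleteEdges_of_mem_cycle hconn hd he₀)
      (hd'.toDeleteEdges _ {e₀} (fun e h h' => hne ((show e = e₀ from h') ▸ h)))
    have h3 := hG S
    rw [edgeCount_eq_card_edgeSet] at h3
    have hSc : Nat.card (S : Set V) = S.card := by simp
    omega

end Sparsity

section Apex

theorem crossCount_map {V W : Type} {G : SimpleGraph V} {H : SimpleGraph W} (e : H ↪g G)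
    (A B : Finset W) :
    crossCount G (A.map e.toEmbedding) (B.map e.toEmbedding) = crossCount H A B := by
  classical
  simp only [crossCount, Finset.sum_map]
  exact Finset.sum_congr rfl fun a _ => Finset.sum_congr rfl fun b _ =>
    if_congr e.map_adj_iff rfl rfl

theorem edgeCount_map {V W : Type} {G : SimpleGraph V} {H : SimpleGraph W} (e : H ↪g G)
    (A : Finset W) : edgeCount G (A.map e.toEmbedding) = edgeCount H A := by
  rw [edgeCount, crossCount_map, edgeCount]

theorem pseudoforest_induce_iff {V : Type} [Finite V] {G : SimpleGraph V} {S : Set V} :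
    Pseudoforest (G.induce S) ↔
      ∀ T : Finset V, (T : Set V) ⊆ S → edgeCount G T ≤ T.card := by
  classical
  rw [pseudoforest_iff_edgeCount]
  constructor
  · intro h T hT
    have hmap : (T.subtype (· ∈ S)).map (Embedding.induce (G := G) S).toEmbedding = T := by
      ext v
      simp only [Finset.mem_map, Finset.mem_subtype]
      exact ⟨fun ⟨w, hw, hwv⟩ => hwv ▸ hw, fun hv => ⟨⟨v, hT hv⟩, hv, rfl⟩⟩
    rw [← hmap, edgeCount_map, Finset.card_map]
    exact h _
  · intro h T
    rw [← edgeCount_map (Embedding.induce (G := G) S),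
      ← Finset.card_map (Embedding.induce (G := G) S).toEmbedding]
    refine h _ fun v hv => ?_
    obtain ⟨w, -, rfl⟩ := Finset.mem_map.1 hv
    exact w.2

theorem apexPseudoforest_iff {V : Type} [Finite V] [Nonempty V] {G : SimpleGraph V} :
    ApexPseudoforest G ↔ ∃ v, ∀ T : Finset V, v ∉ T → edgeCount G T ≤ T.card := by
  constructor
  · rintro ⟨s, hs, h⟩
    rw [pseudoforest_induce_iff] at h
    obtain rfl | ⟨v, rfl⟩ := hs.eq_empty_or_singleton
    · exact ⟨Classical.arbitrary V, fun T _ => h T (by simp)⟩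
    · exact ⟨v, fun T hv => h T (by simpa using hv)⟩
  · rintro ⟨v, h⟩
    exact ⟨{v}, Set.subsingleton_singleton, pseudoforest_induce_iff.2 fun T hT =>
      h T (by simpa using hT)⟩

theorem exists_apex_of_induce {V : Type} [Finite V] {K : SimpleGraph V} {S : Finset V}
    (hS : S.Nonempty) (h : ApexPseudoforest (K.induce (S : Set V))) :
    ∃ v ∈ S, ∀ T ⊆ S, v ∉ T → edgeCount K T ≤ T.card := by
  classical
  obtain ⟨s, hs⟩ := hS
  have : Nonempty (S : Set V) := ⟨⟨s, hs⟩⟩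
  obtain ⟨v, hv⟩ := apexPseudoforest_iff.1 h
  refine ⟨v, v.2, fun T hT hvT => ?_⟩
  have hmap : (T.subtype (· ∈ (S : Set V))).map
      (Embedding.induce (G := K) (S : Set V)).toEmbedding = T := by
    ext w
    simp only [Finset.mem_map, Finset.mem_subtype]
    exact ⟨fun ⟨z, hz, hzw⟩ => hzw ▸ hz, fun hw => ⟨⟨w, hT hw⟩, hw, rfl⟩⟩
  rw [← hmap, edgeCount_map, Finset.card_map]
  exact hv _ (by simpa using hvT)

/-- Every proper minor of an obstruction that is induced on a proper vertex subset has a vertex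
whose removal leaves only sparse sets. -/
theorem ObsApexPseudoforest.exists_apex {V : Type} [Fintype V] {G K : SimpleGraph V}
    (hG : ObsApexPseudoforest G) {S : Finset V} (hS : S.Nonempty) (hSne : S ≠ Finset.univ)
    (hK : IsMinorOf (K.induce (S : Set V)) G) :
    ∃ v ∈ S, ∀ T ⊆ S, v ∉ T → edgeCount K T ≤ T.card := by
  refine exists_apex_of_induce hS (hG.2 _ _ hK ⟨fun e => hSne ?_⟩)
  have h := Nat.card_congr e.toEquiv
  rw [Nat.card_coe_set_eq, Set.ncard_coe_finset, Nat.card_eq_fintype_card] at h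
  exact (Finset.card_eq_iff_eq_univ S).1 h

theorem isMinorOf_induce {V : Type} (G : SimpleGraph V) (S : Set V) :
    IsMinorOf (G.induce S) G := by
  refine ⟨fun w => {w.1}, fun w => ?_, fun w w' h => ?_, fun w w' h => ⟨w, rfl, w', rfl, h⟩⟩
  · have : Subsingleton ({w.1} : Set V) := by simp
    exact Connected.of_subsingleton
  · simpa using fun h' => h (Subtype.ext h')

theorem ObsApexPseudoforest.exists_dense {V : Type} [Finite V] {G : SimpleGraph V}
    (hG : ObsApexPseudoforest G) (v : V) : ∃ T : Finset V, v ∉ T ∧ T.card < edgeCount G T := by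
  have : Nonempty V := ⟨v⟩
  by_contra! h
  exact hG.1 (apexPseudoforest_iff.2 ⟨v, h⟩)

theorem not_apexPseudoforest_mkGraph {n : ℕ} [NeZero n] {E : List (ℕ × ℕ)}
    (C : List (Finset (Fin n)))
    (h : ∀ v : Fin n, ∃ S ∈ C, v ∉ S ∧ S.card < (∑ a ∈ S, ∑ b ∈ S,
      if a ≠ b ∧ (((a : ℕ), (b : ℕ)) ∈ E ∨ ((b : ℕ), (a : ℕ)) ∈ E) then 1 else 0) / 2) :
    ¬ ApexPseudoforest (mkGraph n E) := by
  intro ha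
  obtain ⟨v, hv⟩ := apexPseudoforest_iff.1 ha
  obtain ⟨S, -, hvS, hS⟩ := h v
  refine absurd (hv S hvS) (not_le.2 (hS.trans_eq ?_))
  unfold edgeCount crossCount
  congr 1
  exact Finset.sum_congr rfl fun a _ => Finset.sum_congr rfl fun b _ => by congr

theorem not_apexPseudoforest_O1 : ¬ ApexPseudoforest O1 :=
  not_apexPseudoforest_mkGraph [{0, 1, 2, 3}, {4, 5, 6, 7}] (by decide +kernel)

theorem not_apexPseudoforest_O2 : ¬ ApexPseudoforest O2 :=
  not_apexPseudoforest_mkGraph [{0, 1, 2, 3, 4}, {5, 6, 7, 8, 9}] (by decide +kernel)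

theorem not_apexPseudoforest_O3 : ¬ ApexPseudoforest O3 :=
  not_apexPseudoforest_mkGraph [{0, 1, 2, 3}, {4, 5, 6, 7, 8}] (by decide +kernel)

theorem not_apexPseudoforest_O4 : ¬ ApexPseudoforest O4 :=
  not_apexPseudoforest_mkGraph [{3, 4, 5, 6, 7}, {0, 1, 2, 3, 4}, {0, 1, 2, 3, 5, 6, 7},
    {0, 1, 2, 4, 5, 6, 7}] (by decide +kernel)

theorem not_apexPseudoforest_O12 : ¬ ApexPseudoforest O12 :=
  not_apexPseudoforest_mkGraph [{0, 1, 2, 3, 4, 5}, {0, 1, 2, 6, 7, 8}, {3, 4, 5, 6, 7, 8}]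
    (by decide +kernel)

theorem not_apexPseudoforest_O13 : ¬ ApexPseudoforest O13 :=
  not_apexPseudoforest_mkGraph [{0, 1, 2, 3, 4, 5}, {0, 1, 2, 6, 7, 8}, {3, 4, 5, 6, 7, 8}]
    (by decide +kernel)

theorem not_apexPseudoforest_O15 : ¬ ApexPseudoforest O15 :=
  not_apexPseudoforest_mkGraph [{0, 1, 2, 3, 4}, {4, 5, 6, 7, 8}, {0, 1, 2, 6, 7, 8}]
    (by decide +kernel)

end Apex

section Models

variable {V : Type} [DecidableEq V] {G : SimpleGraph V}

/-- The sets in `L` are disjoint branch sets of a minor of `G` with the edge list `E`. -/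
def Model (G : SimpleGraph V) (L : List (Finset V)) (E : List (ℕ × ℕ)) : Prop :=
  L.Pairwise Disjoint ∧ (∀ A ∈ L, Conn G A) ∧ ∀ p ∈ E, Touch G (L.getD p.1 ∅) (L.getD p.2 ∅)

theorem Model.isMinorOf {L : List (Finset V)} {E : List (ℕ × ℕ)} (h : Model G L E) {n : ℕ}
    (hn : L.length = n) : IsMinorOf (mkGraph n E) G := by
  subst hn
  have hget (i : Fin L.length) : L.getD i ∅ = L.get i := List.getD_eq_getElem _ _ i.2
  refine ⟨fun i => L.get i, fun i => (h.2.1 _ (L.get_mem i)).induce_connected, fun i j hij => ?_,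
    fun i j hij => ?_⟩
  · rw [Finset.disjoint_coe]
    rcases lt_or_gt_of_ne hij with hlt | hlt
    · exact List.pairwise_iff_get.1 h.1 _ _ hlt
    · exact (List.pairwise_iff_get.1 h.1 _ _ hlt).symm
  · have ht : Touch G (L.get i) (L.get j) := by
      rcases (fromRel_adj _ _ _).1 hij with ⟨-, hE | hE⟩
      · simpa only [hget] using h.2.2 _ hE
      · simpa only [hget] using (h.2.2 _ hE).symm
    obtain ⟨a, ha, b, hb, hab⟩ := ht
    exact ⟨a, ha, b, hb, hab⟩

theorem Model.append {L L' : List (Finset V)} {E E' : List (ℕ × ℕ)} (h : Model G L E)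
    (h' : Model G L' E') (hE : ∀ p ∈ E, p.1 < L.length ∧ p.2 < L.length)
    (hd : ∀ A ∈ L, ∀ B ∈ L', Disjoint A B) :
    Model G (L ++ L') (E ++ E'.map fun p => (L.length + p.1, L.length + p.2)) := by
  refine ⟨List.pairwise_append.2 ⟨h.1, h'.1, hd⟩, fun A hA => ?_, fun p hp => ?_⟩
  · rcases List.mem_append.1 hA with hA | hA
    · exact h.2.1 A hA
    · exact h'.2.1 A hA
  · rcases List.mem_append.1 hp with hp | hp
    · rw [List.getD_append _ _ _ _ (hE p hp).1, List.getD_append _ _ _ _ (hE p hp).2]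
      exact h.2.2 p hp
    · obtain ⟨q, hq, rfl⟩ := List.mem_map.1 hp
      rw [List.getD_append_right _ _ _ _ (by simp), List.getD_append_right _ _ _ _ (by simp)]
      simpa using h'.2.2 q hq

omit [DecidableEq V] in
theorem ObsApexPseudoforest.not_isMinorOf (h1 : ObsApexPseudoforest G) (h2 : ¬ InO G) {n : ℕ}
    {H : SimpleGraph (Fin n)} (hO : ⟨n, H⟩ ∈ OList) (hH : ¬ ApexPseudoforest H) :
    ¬ IsMinorOf H G :=
  fun hm => hH (h1.2 _ _ hm ⟨fun e => h2 ⟨_, hO, ⟨e.symm⟩⟩⟩)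

end Models
section Bicyclic

variable {V : Type} [DecidableEq V] {G : SimpleGraph V}

/-- Splitting a connected set at a component `Z` left after deleting the vertex `x`. -/
theorem Conn.cut_comp {S Z : Finset V} {x : V} (hS : Conn G S) (hx : x ∈ S)
    (hZ : IsComp G (S \ {x}) Z) :
    Conn G (S \ Z) ∧ x ∈ S \ Z ∧
      edgeCount G S = edgeCount G (S \ Z) + edgeCount G Z + crossCount G {x} Z ∧
      1 ≤ crossCount G {x} Z ∧ S.card = (S \ Z).card + Z.card := by
  have hZS : Z ⊆ S := hZ.1.trans Finset.sdiff_subset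
  have hxZ : x ∉ Z := fun h => by simpa using hZ.1 h
  have hxW : x ∈ S \ Z := by simp [hx, hxZ]
  have hsplit : S \ Z = {x} ∪ ((S \ {x}) \ Z) := by
    ext v
    simp only [Finset.mem_sdiff, Finset.mem_union, Finset.mem_singleton]
    by_cases h : v = x
    · subst h; simp [hx, hxZ]
    · simp [h]
  have hcr : crossCount G Z (S \ Z) = crossCount G {x} Z := by
    rw [hsplit, crossCount_union_right (by simp), crossCount_eq_zero.2 hZ.2.2,
      crossCount_comm, add_zero]
  refine ⟨hS.sdiff_comp (conn_singleton x) (by simpa using hx) hZ, hxW, ?_, ?_, ?_⟩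
  · have := edgeCount_sdiff_add (G := G) hZS
    omega
  · rw [← hcr]
    exact crossCount_pos.2 (hS.touch hZS hZ.2.1.1 fun h => hxZ (h ▸ hx))
  · have := Finset.card_sdiff_add_card_eq_card hZS
    omega

omit [DecidableEq V] in
theorem touch_of_adj {A B : Finset V} {a b : V} (ha : a ∈ A) (hb : b ∈ B) (h : G.Adj a b) :
    Touch G A B := ⟨a, ha, b, hb, h⟩

theorem Touch.union_right {A B C : Finset V} (h : Touch G A (B ∪ C)) :
    Touch G A B ∨ Touch G A C := by
  obtain ⟨a, ha, b, hb, hab⟩ := h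
  rcases Finset.mem_union.1 hb with hb | hb
  · exact Or.inl ⟨a, ha, b, hb, hab⟩
  · exact Or.inr ⟨a, ha, b, hb, hab⟩

/-- A connected set with a cycle contracts to a triangle rooted at any of its vertices. -/
theorem Conn.exists_triangle {S : Finset V} {x : V} (hS : Conn G S) (hx : x ∈ S)
    (h : S.card ≤ edgeCount G S) :
    ∃ A B C, A ∪ B ∪ C = S ∧ Disjoint A B ∧ Disjoint A C ∧ Disjoint B C ∧
      Conn G A ∧ Conn G B ∧ Conn G C ∧ Touch G A B ∧ Touch G A C ∧ Touch G B C ∧ x ∈ A := by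
  induction hn : S.card using Nat.strong_induction_on generalizing S x with
  | _ n ih =>
    obtain ⟨p₀, hp₀⟩ : (S \ {x}).Nonempty := by
      rw [Finset.sdiff_nonempty]
      intro hs
      have : S = {x} := Finset.Subset.antisymm hs (by simpa using hx)
      subst this
      simp [edgeCount_singleton] at h
    obtain ⟨Z, hZ, -⟩ := exists_isComp (G := G) (conn_singleton p₀)
      (S := S \ {x}) (by simpa using hp₀)
    obtain ⟨hW, hxW, he, hd, hc⟩ := hS.cut_comp hx hZ
    have hZS : Z ⊆ S := hZ.1.trans Finset.sdiff_subset
    have hdWZ : Disjoint (S \ Z) Z := Finset.sdiff_disjoint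
    have huWZ : S \ Z ∪ Z = S := Finset.sdiff_union_of_subset hZS
    generalize S \ Z = W at *
    have hWc := Finset.card_pos.2 hW.1
    have hZc := Finset.card_pos.2 hZ.2.1.1
    by_cases hd2 : 2 ≤ crossCount G {x} Z
    · obtain ⟨p, hp, q, hq, hpq, hxp, hxq⟩ := two_le_crossCount hd2
      obtain ⟨A, B, hAB, hABZ, hA, hB, hpA, hqB, htAB⟩ := hZ.2.1.split hp hq hpq
      subst hABZ
      rw [Finset.disjoint_union_right] at hdWZ
      exact ⟨W, A, B, by rw [Finset.union_assoc, huWZ], hdWZ.1, hdWZ.2, hAB, hW, hA, hB,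
        touch_of_adj hxW hpA hxp, touch_of_adj hxW hqB hxq, htAB, hxW⟩
    · have hd1 : crossCount G {x} Z = 1 := by omega
      obtain ⟨x', hx', p, hp, hxp⟩ := crossCount_pos.1 (by omega : 0 < crossCount G {x} Z)
      rw [Finset.mem_singleton] at hx'
      subst hx'
      rcases le_or_gt Z.card (edgeCount G Z) with hZe | hZe
      · obtain ⟨A, B, C, hu, hAB, hAC, hBC, hA, hB, hC, tAB, tAC, tBC, hpA⟩ :=
          ih _ (by omega) hZ.2.1 hp hZe rfl
        subst hu
        simp only [Finset.disjoint_union_right] at hdWZ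
        refine ⟨W ∪ A, B, C, by rw [← huWZ]; simp only [Finset.union_assoc], ?_, ?_, hBC,
          hW.union hA (Or.inl (touch_of_adj hxW hpA hxp)), hB, hC,
          tAB.mono Finset.subset_union_right subset_rfl,
          tAC.mono Finset.subset_union_right subset_rfl, tBC, Finset.mem_union_left _ hxW⟩
        · exact Finset.disjoint_union_left.2 ⟨hdWZ.1.2, hAB⟩
        · exact Finset.disjoint_union_left.2 ⟨hdWZ.2, hAC⟩
      · obtain ⟨A, B, C, hu, hAB, hAC, hBC, hA, hB, hC, tAB, tAC, tBC, hpA⟩ :=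
          ih _ (by omega) hW hxW (by omega) rfl
        subst hu
        simp only [Finset.disjoint_union_left] at hdWZ
        refine ⟨A ∪ Z, B, C, by rw [← huWZ]; ac_rfl, ?_, ?_, hBC,
          hA.union hZ.2.1 (Or.inl (touch_of_adj hpA hp hxp)), hB, hC,
          tAB.mono Finset.subset_union_left subset_rfl,
          tAC.mono Finset.subset_union_left subset_rfl, tBC, Finset.mem_union_left _ hpA⟩
        · exact Finset.disjoint_union_left.2 ⟨hAB, hdWZ.1.2.symm⟩
        · exact Finset.disjoint_union_left.2 ⟨hAC, hdWZ.2.symm⟩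

/-- A connected set with three edges to a vertex `x` contracts to a path on three vertices each
of which is joined to `x`. -/
theorem Conn.exists_split_three {Z : Finset V} {x : V} (hZ : Conn G Z)
    (h : 3 ≤ crossCount G {x} Z) : ∃ A B C, A ∪ B ∪ C = Z ∧ Disjoint A B ∧ Disjoint A C ∧
      Disjoint B C ∧ Conn G A ∧ Conn G B ∧ Conn G C ∧ Touch G A B ∧ Touch G B C ∧
      Touch G {x} A ∧ Touch G {x} B ∧ Touch G {x} C := by
  classical
  rw [crossCount_singleton_left] at h
  obtain ⟨p, hp, q, hq, r, hr, hpq, hpr, hqr⟩ := Finset.two_lt_card.1 h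
  rw [Finset.mem_filter] at hp hq hr
  have key : ∀ {p q r : V} {P Q : Finset V}, Disjoint P Q → P ∪ Q = Z → Conn G P → Conn G Q →
      Touch G P Q → p ∈ P → q ∈ Q → r ∈ P → p ≠ r → G.Adj x p → G.Adj x q → G.Adj x r →
      ∃ A B C, A ∪ B ∪ C = Z ∧ Disjoint A B ∧ Disjoint A C ∧
      Disjoint B C ∧ Conn G A ∧ Conn G B ∧ Conn G C ∧ Touch G A B ∧ Touch G B C ∧
      Touch G {x} A ∧ Touch G {x} B ∧ Touch G {x} C := by
    intro p q r P Q hd hu hP hQ ht hp hq hr hpr hxp hxq hxr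
    obtain ⟨A, B, hAB, rfl, hA, hB, hpA, hrB, tAB⟩ := hP.split hp hr hpr
    rw [Finset.disjoint_union_left] at hd
    have tp := touch_of_adj (Finset.mem_singleton_self x) hpA hxp
    have tr := touch_of_adj (Finset.mem_singleton_self x) hrB hxr
    have tq := touch_of_adj (Finset.mem_singleton_self x) hq hxq
    rcases ht.symm.union_right with h | h
    · exact ⟨Q, A, B, by rw [← hu]; ac_rfl, hd.1.symm, hd.2.symm, hAB, hQ, hA, hB, h, tAB,
        tq, tp, tr⟩
    · exact ⟨A, B, Q, hu, hAB, hd.1, hd.2, hA, hB, hQ, tAB, h.symm, tp, tr, tq⟩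
  obtain ⟨P, Q, hPQ, hu, hP, hQ, hpP, hqQ, tPQ⟩ := hZ.split hp.1 hq.1 hpq
  rcases Finset.mem_union.1 (hu ▸ hr.1) with hrP | hrQ
  · exact key hPQ hu hP hQ tPQ hpP hqQ hrP hpr hp.2 hq.2 hr.2
  · exact key hPQ.symm (by rw [← hu, Finset.union_comm]) hQ hP tPQ.symm hqQ hpP hrQ hqr
      hq.2 hp.2 hr.2

def diamondEdges : List (ℕ × ℕ) := [(0, 1), (0, 2), (0, 3), (1, 2), (1, 3)]

def butterflyEdges : List (ℕ × ℕ) := [(0, 1), (0, 2), (1, 2), (0, 3), (0, 4), (3, 4)]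

theorem model_diamond {A B C D : Finset V} (hA : Conn G A) (hB : Conn G B) (hC : Conn G C)
    (hD : Conn G D) (hd : [A, B, C, D].Pairwise Disjoint) (h1 : Touch G A B) (h2 : Touch G A C)
    (h3 : Touch G A D) (h4 : Touch G B C) (h5 : Touch G B D) :
    Model G [A, B, C, D] diamondEdges :=
  ⟨hd, by simp [*], by simp [diamondEdges, *]⟩

theorem model_butterfly {A B C D E : Finset V} (hA : Conn G A) (hB : Conn G B) (hC : Conn G C)
    (hD : Conn G D) (hE : Conn G E) (hd : [A, B, C, D, E].Pairwise Disjoint) (h1 : Touch G A B)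
    (h2 : Touch G A C) (h3 : Touch G B C) (h4 : Touch G A D) (h5 : Touch G A E)
    (h6 : Touch G D E) : Model G [A, B, C, D, E] butterflyEdges :=
  ⟨hd, by simp [*], by simp [butterflyEdges, *]⟩

/-- `S` contains the branch sets of a diamond or of a butterfly. -/
def HasBicycle (G : SimpleGraph V) (S : Finset V) : Prop :=
  ∃ L : List (Finset V), (∀ A ∈ L, A ⊆ S) ∧
    (L.length = 4 ∧ Model G L diamondEdges ∨ L.length = 5 ∧ Model G L butterflyEdges)

theorem HasBicycle.mono {S T : Finset V} (h : HasBicycle G S) (hST : S ⊆ T) : HasBicycle G T := by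
  obtain ⟨L, hL, h⟩ := h
  exact ⟨L, fun A hA => (hL A hA).trans hST, h⟩

theorem Conn.hasBicycle {S : Finset V} (hS : Conn G S) (h : S.card < edgeCount G S) :
    HasBicycle G S := by
  induction hn : S.card using Nat.strong_induction_on generalizing S with
  | _ n ih =>
    obtain ⟨x, hx⟩ := hS.1
    obtain ⟨p₀, hp₀⟩ : (S \ {x}).Nonempty := by
      rw [Finset.sdiff_nonempty]
      intro hs
      have : S = {x} := Finset.Subset.antisymm hs (by simpa using hx)
      subst this
      simp [edgeCount_singleton] at h
    obtain ⟨Z, hZ, -⟩ := exists_isComp (G := G) (conn_singleton p₀)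
      (S := S \ {x}) (by simpa using hp₀)
    obtain ⟨hW, hxW, he, hd, hc⟩ := hS.cut_comp hx hZ
    have hZS : Z ⊆ S := hZ.1.trans Finset.sdiff_subset
    have hdWZ : Disjoint (S \ Z) Z := Finset.sdiff_disjoint
    have huWZ : S \ Z ∪ Z = S := Finset.sdiff_union_of_subset hZS
    replace hZ := hZ.2.1
    generalize S \ Z = W at *
    subst huWZ
    have hWc := Finset.card_pos.2 hW.1
    have hZc := Finset.card_pos.2 hZ.1
    have hWt := hW.card_le
    have hZt := hZ.card_le
    by_cases hd2 : 2 ≤ crossCount G {x} Z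
    · obtain ⟨p, hp, q, hq, hpq, hxp, hxq⟩ := two_le_crossCount hd2
      by_cases hWe : W.card ≤ edgeCount G W
      · obtain ⟨A, B, C, rfl, hAB, hAC, hBC, hA, hB, hC, tAB, tAC, tBC, hxA⟩ :=
          hW.exists_triangle hxW hWe
        obtain ⟨P, Q, hPQ, rfl, hP, hQ, hpP, hqQ, tPQ⟩ := hZ.split hp hq hpq
        simp only [Finset.disjoint_union_left, Finset.disjoint_union_right] at hdWZ
        exact ⟨[A, B, C, P, Q], by simp; grind, Or.inr ⟨rfl, model_butterfly hA hB hC hP hQ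
          (by simp [*]) tAB tAC tBC (touch_of_adj hxA hpP hxp) (touch_of_adj hxA hqQ hxq) tPQ⟩⟩
      by_cases hZe : Z.card ≤ edgeCount G Z
      · obtain ⟨A, B, C, rfl, hAB, hAC, hBC, hA, hB, hC, tAB, tAC, tBC, hpA⟩ :=
          hZ.exists_triangle hp hZe
        simp only [Finset.disjoint_union_right] at hdWZ
        have tWA : Touch G A W := (touch_of_adj hxW hpA hxp).symm
        simp only [Finset.mem_union] at hq
        rcases hq with (hqA | hqB) | hqC
        · obtain ⟨P, Q, hPQ, rfl, hP, hQ, hpP, hqQ, tPQ⟩ := hA.split hpA hqA hpq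
          have tP : Touch G P W := (touch_of_adj hxW hpP hxp).symm
          have tQ : Touch G Q W := (touch_of_adj hxW hqQ hxq).symm
          simp only [Finset.disjoint_union_left, Finset.disjoint_union_right] at hdWZ hAB hAC
          rcases tAB.symm.union_right with hB' | hB' <;> rcases tAC.symm.union_right with hC' | hC'
          · exact ⟨[P, W, Q, B, C], by simp; grind, Or.inr ⟨rfl, model_butterfly hP hW hQ hB hC
              (by simp [*, disjoint_comm, hAB.1.symm, hAB.2.symm, hAC.1.symm, hAC.2.symm]) tP tPQ tQ.symm hB'.symm hC'.symm tBC⟩⟩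
          · exact ⟨[P, Q, W, B ∪ C], by simp; grind, Or.inl ⟨rfl, model_diamond hP hQ hW
              (hB.union hC (Or.inl tBC)) (by simp [*, disjoint_comm, hAB.1.symm, hAB.2.symm, hAC.1.symm, hAC.2.symm]) tPQ tP
              (hB'.symm.mono subset_rfl Finset.subset_union_left) tQ
              (hC'.symm.mono subset_rfl Finset.subset_union_right)⟩⟩
          · exact ⟨[P, Q, W, B ∪ C], by simp; grind, Or.inl ⟨rfl, model_diamond hP hQ hW
              (hB.union hC (Or.inl tBC)) (by simp [*, disjoint_comm, hAB.1.symm, hAB.2.symm, hAC.1.symm, hAC.2.symm]) tPQ tP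
              (hC'.symm.mono subset_rfl Finset.subset_union_right) tQ
              (hB'.symm.mono subset_rfl Finset.subset_union_left)⟩⟩
          · exact ⟨[Q, W, P, B, C], by simp; grind, Or.inr ⟨rfl, model_butterfly hQ hW hP hB hC
              (by simp [*, disjoint_comm, hAB.1.symm, hAB.2.symm, hAC.1.symm, hAC.2.symm]) tQ tPQ.symm tP.symm hB'.symm hC'.symm tBC⟩⟩
        · exact ⟨[A, B, C, W], by simp; grind, Or.inl ⟨rfl, model_diamond hA hB hC hW
            (by simp [*, disjoint_comm]) tAB tAC tWA tBC (touch_of_adj hxW hqB hxq).symm⟩⟩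
        · exact ⟨[A, C, B, W], by simp; grind, Or.inl ⟨rfl, model_diamond hA hC hB hW
            (by simp [*, disjoint_comm]) tAC tAB tWA tBC.symm (touch_of_adj hxW hqC hxq).symm⟩⟩
      · obtain ⟨A, B, C, rfl, hAB, hAC, hBC, hA, hB, hC, tAB, tBC, tA, tB, tC⟩ :=
          hZ.exists_split_three (x := x) (by omega)
        simp only [Finset.disjoint_union_right] at hdWZ
        have hxW' : {x} ⊆ W := by simpa using hxW
        exact ⟨[W, B, A, C], by simp; grind, Or.inl ⟨rfl, model_diamond hW hB hA hC
          (by simp [*, disjoint_comm]) (tB.mono hxW' subset_rfl) (tA.mono hxW' subset_rfl)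
          (tC.mono hxW' subset_rfl) tAB.symm tBC⟩⟩
    · rcases lt_or_ge W.card (edgeCount G W) with hWe | hWe
      · exact (ih _ (by omega) hW hWe rfl).mono Finset.subset_union_left
      rcases lt_or_ge Z.card (edgeCount G Z) with hZe | hZe
      · exact (ih _ (by omega) hZ hZe rfl).mono Finset.subset_union_right
      obtain ⟨x', hx', p, hp, hxp⟩ := crossCount_pos.1 (by omega : 0 < crossCount G {x} Z)
      rw [Finset.mem_singleton] at hx'
      subst hx'
      obtain ⟨A, B, C, rfl, hAB, hAC, hBC, hA, hB, hC, tAB, tAC, tBC, hxA⟩ :=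
        hW.exists_triangle hxW (by omega)
      obtain ⟨A', B', C', rfl, hAB', hAC', hBC', hA', hB', hC', tAB', tAC', tBC', hpA'⟩ :=
        hZ.exists_triangle hp (by omega)
      simp only [Finset.disjoint_union_left, Finset.disjoint_union_right] at hdWZ
      exact ⟨[A ∪ A', B, C, B', C'], by simp; grind, Or.inr ⟨rfl, model_butterfly
        (hA.union hA' (Or.inl (touch_of_adj hxA hpA' hxp))) hB hC hB' hC'
        (by simp [*, disjoint_comm])
        (tAB.mono Finset.subset_union_left subset_rfl)
        (tAC.mono Finset.subset_union_left subset_rfl) tBC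
        (tAB'.mono Finset.subset_union_right subset_rfl)
        (tAC'.mono Finset.subset_union_right subset_rfl) tBC'⟩⟩

theorem hasBicycle_of_card_lt {S : Finset V} (h : S.card < edgeCount G S) : HasBicycle G S := by
  obtain ⟨T, hT, hlt⟩ := exists_isComp_card_lt (G := G) (edgeCount G) edgeCount_empty
    (fun A B => edgeCount_union_of_not_touch) h
  exact (hT.2.1.hasBicycle hlt).mono hT.1

/-- An obstruction outside the list has no two disjoint vertex sets each with more edges than
vertices. -/
theorem ObsApexPseudoforest.not_disjoint_of_card_lt (h1 : ObsApexPseudoforest G) (h2 : ¬ InO G)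
    {S T : Finset V} (hS : S.card < edgeCount G S) (hT : T.card < edgeCount G T) :
    ¬ Disjoint S T := by
  intro hd
  obtain ⟨L, hLS, hL⟩ := hasBicycle_of_card_lt hS
  obtain ⟨M, hMT, hM⟩ := hasBicycle_of_card_lt hT
  have hLM : ∀ A ∈ L, ∀ B ∈ M, Disjoint A B := fun A hA B hB =>
    Finset.disjoint_of_subset_left (hLS A hA) (Finset.disjoint_of_subset_right (hMT B hB) hd)
  rcases hL with ⟨hl, hL⟩ | ⟨hl, hL⟩ <;> rcases hM with ⟨hm, hM⟩ | ⟨hm, hM⟩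
  · have h := hL.append hM (by rw [hl]; decide) hLM
    rw [hl] at h
    exact h1.not_isMinorOf h2 (by simp [OList]) not_apexPseudoforest_O1
      (h.isMinorOf (by simp [hl, hm]))
  · have h := hL.append hM (by rw [hl]; decide) hLM
    rw [hl] at h
    exact h1.not_isMinorOf h2 (by simp [OList]) not_apexPseudoforest_O3
      (h.isMinorOf (by simp [hl, hm]))
  · have h := hM.append hL (by rw [hm]; decide) fun A hA B hB => (hLM B hB A hA).symm
    rw [hm] at h
    exact h1.not_isMinorOf h2 (by simp [OList]) not_apexPseudoforest_O3
      (h.isMinorOf (by simp [hl, hm]))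
  · have h := hL.append hM (by rw [hl]; decide) hLM
    rw [hl] at h
    exact h1.not_isMinorOf h2 (by simp [OList]) not_apexPseudoforest_O2
      (h.isMinorOf (by simp [hl, hm]))

end Bicyclic
section Pendant

variable {V : Type} [DecidableEq V] {G : SimpleGraph V}

theorem isMinorOf_induce_of_branch {K : SimpleGraph V} {S : Finset V} (F : V → Finset V)
    (hc : ∀ w ∈ S, Conn G (F w)) (hd : ∀ w ∈ S, ∀ w' ∈ S, w ≠ w' → Disjoint (F w) (F w'))
    (ht : ∀ w ∈ S, ∀ w' ∈ S, K.Adj w w' → Touch G (F w) (F w')) :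
    IsMinorOf (K.induce (S : Set V)) G :=
  ⟨fun w => F w, fun w => (hc w w.2).induce_connected,
    fun w w' h => Finset.disjoint_coe.2 (hd w w.2 w' w'.2 fun h' => h (Subtype.ext h')),
    fun w w' h => ht w w.2 w' w'.2 h⟩

omit [DecidableEq V] in
theorem crossCount_congr {K : SimpleGraph V} {A B : Finset V}
    (h : ∀ a ∈ A, ∀ b ∈ B, (G.Adj a b ↔ K.Adj a b)) : crossCount G A B = crossCount K A B := by
  classical
  exact Finset.sum_congr rfl fun a ha => Finset.sum_congr rfl fun b hb =>
    if_congr (h a ha b hb) rfl rfl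

variable [Fintype V]

theorem ObsApexPseudoforest.conn_univ (h1 : ObsApexPseudoforest G) (h2 : ¬ InO G) (x : V) :
    Conn G Finset.univ := by
  obtain ⟨Z, hZ, -⟩ := exists_isComp (G := G) (conn_singleton x) (Finset.subset_univ _)
  by_contra hn
  have key : ∀ A B T : Finset V, A ∪ B = Finset.univ → Disjoint A B → ¬ Touch G A B →
      B.Nonempty → T ⊆ A → T.card < edgeCount G T → False := by
    intro A B T hu hd ht hB hTA hT
    have hA : A ≠ Finset.univ := by
      rintro rfl
      obtain ⟨b, hb⟩ := hB
      exact Finset.disjoint_left.1 hd (Finset.mem_univ b) hb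
    have hAn : A.Nonempty := by
      rw [Finset.nonempty_iff_ne_empty]
      rintro rfl
      rw [Finset.subset_empty] at hTA
      subst hTA
      simp [edgeCount_empty] at hT
    obtain ⟨v, hv, hvT⟩ := h1.exists_apex hAn hA (isMinorOf_induce G _)
    obtain ⟨U, hvU, hU⟩ := h1.exists_dense v
    have hsp : U = (U ∩ A) ∪ (U ∩ B) := by
      rw [← Finset.inter_union_distrib_left, hu, Finset.inter_univ]
    have hdU : Disjoint (U ∩ A) (U ∩ B) :=
      hd.mono Finset.inter_subset_right Finset.inter_subset_right
    have hcard := Finset.card_union_of_disjoint hdU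
    have hedge := edgeCount_union_of_not_touch (G := G) hdU fun h =>
      ht (h.mono Finset.inter_subset_right Finset.inter_subset_right)
    rw [← hsp] at hcard hedge
    have hUA := hvT (U ∩ A) Finset.inter_subset_right (by simp [hvU])
    have hUB : (U ∩ B).card < edgeCount G (U ∩ B) := by omega
    exact h1.not_disjoint_of_card_lt h2 hT hUB (hd.mono hTA Finset.inter_subset_right)
  have hZc : (Finset.univ \ Z).Nonempty := by
    rw [Finset.sdiff_nonempty]
    intro h
    exact hn (Finset.univ_subset_iff.1 h ▸ hZ.2.1)
  obtain ⟨T, -, hT⟩ := h1.exists_dense x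
  obtain ⟨S, hS, hlt⟩ := exists_isComp_card_lt (G := G) (edgeCount G) edgeCount_empty
    (fun A B => edgeCount_union_of_not_touch) hT
  have hu : Z ∪ (Finset.univ \ Z) = Finset.univ := Finset.union_sdiff_of_subset hZ.1
  rcases hS.2.1.subset_or (P := Z) (Q := Finset.univ \ Z) (by rw [hu]; exact Finset.subset_univ _) hZ.2.2
    with h | h
  · exact key _ _ S hu Finset.disjoint_sdiff hZ.2.2 hZc h hlt
  · exact key (Finset.univ \ Z) Z S (by rw [Finset.union_comm, hu]) Finset.sdiff_disjoint (fun h => hZ.2.2 h.symm)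
      hZ.2.1.1 h hlt

/-- The triangle `x b c` is attached to the rest of the graph only at `x`. -/
def PendantTriangle (G : SimpleGraph V) (x b c : V) : Prop :=
  G.Adj x b ∧ G.Adj x c ∧ G.Adj b c ∧ (∀ w, G.Adj b w → w = x ∨ w = c) ∧
    ∀ w, G.Adj c w → w = x ∨ w = b

theorem ObsApexPseudoforest.exists_pendantTriangle (h1 : ObsApexPseudoforest G) (h2 : ¬ InO G)
    {x : V} (hx : ¬ Conn G (Finset.univ \ {x})) :
    ∃ b c, PendantTriangle G x b c ∧ Conn G (Finset.univ \ {x, b, c}) ∧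
      (Finset.univ \ {x, b, c}).card < edgeCount G (Finset.univ \ {x, b, c}) := by
  obtain ⟨T, hxT, hT⟩ := h1.exists_dense x
  obtain ⟨S, hS, hlt⟩ := exists_isComp_card_lt (G := G) (edgeCount G) edgeCount_empty
    (fun A B => edgeCount_union_of_not_touch) hT
  obtain ⟨Z, hZ, hSZ⟩ := exists_isComp (G := G) (S := Finset.univ \ {x}) hS.2.1
    fun v hv => by
      rw [Finset.mem_sdiff, Finset.mem_singleton]
      exact ⟨Finset.mem_univ v, fun h => hxT (h ▸ hS.1 hv)⟩
  obtain ⟨hR, hxR, -⟩ := (h1.conn_univ h2 x).cut_comp (Finset.mem_univ x) hZ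
  have hZd : Z.card < edgeCount G Z := by
    have := hZ.2.1.edgeCount_mono hS.2.1.1 hSZ
    omega
  have hmR : ∀ v, v ∈ Finset.univ \ Z ↔ v ∉ Z := by simp
  have hZR : ∀ v ∈ Z, ∀ w ∉ Z, G.Adj v w → w = x := by
    intro v hv w hw hvw
    by_contra hwx
    exact hZ.2.2 ⟨v, hv, w, by simp [hw, hwx], hvw⟩
  generalize Finset.univ \ Z = R at *
  have hxZ : x ∉ Z := (hmR x).1 hxR
  have hZRd : Disjoint Z R := Finset.disjoint_left.2 fun v hv hv' => (hmR v).1 hv' hv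
  have hRe : edgeCount G R ≤ R.card := by
    by_contra! h
    exact h1.not_disjoint_of_card_lt h2 hZd h hZRd
  obtain ⟨y, hyR, hyx⟩ : ∃ y ∈ R, y ≠ x := by
    by_contra! h
    refine hx ?_
    have : Finset.univ \ {x} = Z := by
      ext v
      have := h v
      have := hmR v
      simp only [Finset.mem_sdiff, Finset.mem_univ, true_and, Finset.mem_singleton]
      grind
    rw [this]
    exact hZ.2.1
  have hmono : ∀ Q ⊆ R, Q.Nonempty → edgeCount G Q + R.card ≤ edgeCount G R + Q.card :=
    fun Q hQ hQn => hR.edgeCount_mono hQn hQ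
  -- The edges in an arbitrary set, in terms of its parts in `Z` and in `R`.
  have hsplit : ∀ U : Finset V, U.card = (U ∩ Z).card + (U ∩ R).card ∧
      edgeCount G U = edgeCount G (U ∩ Z) + edgeCount G (U ∩ R) +
        crossCount G (U ∩ Z) (U ∩ {x}) := by
    intro U
    have hu : U = (U ∩ Z) ∪ (U ∩ R) := by
      ext v
      have := hmR v
      simp only [Finset.mem_union, Finset.mem_inter]
      tauto
    have hd : Disjoint (U ∩ Z) (U ∩ R) :=
      hZRd.mono Finset.inter_subset_right Finset.inter_subset_right
    have h1 := Finset.card_union_of_disjoint hd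
    have h2 := edgeCount_union (G := G) hd
    rw [← hu] at h1 h2
    refine ⟨h1, h2.trans ?_⟩
    have hR' : U ∩ R = (U ∩ {x}) ∪ ((U ∩ R) \ {x}) := by
      ext v
      simp only [Finset.mem_union, Finset.mem_inter, Finset.mem_sdiff, Finset.mem_singleton]
      by_cases hv : v = x
      · subst hv; simp [hxR]
      · simp [hv]
    have h0 : crossCount G (U ∩ Z) ((U ∩ R) \ {x}) = 0 := by
      rw [crossCount_eq_zero]
      rintro ⟨v, hv, w, hw, hvw⟩
      simp only [Finset.mem_inter, Finset.mem_sdiff, Finset.mem_singleton] at hv hw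
      exact hw.2 (hZR v hv.2 w ((hmR w).1 hw.1.2) hvw)
    have hdx : Disjoint (U ∩ {x}) ((U ∩ R) \ {x}) :=
      Finset.disjoint_left.2 fun v hv hv' => by simp at hv hv'; tauto
    have := crossCount_union_right (G := G) (C := U ∩ Z) hdx
    rw [← hR', h0] at this
    omega
  rcases hRe.lt_or_eq with hRe | hRe
  · obtain ⟨v, hv, hvT⟩ := h1.exists_apex (S := insert x Z) ⟨x, Finset.mem_insert_self _ _⟩
      (fun h => by
        have := Finset.mem_univ y
        rw [← h, Finset.mem_insert] at this
        rcases this with h | h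
        · exact hyx h
        · exact (hmR y).1 hyR h) (isMinorOf_induce G _)
    obtain ⟨U, hvU, hU⟩ := h1.exists_dense v
    obtain ⟨hc, he⟩ := hsplit U
    have hdx : Disjoint (U ∩ Z) (U ∩ {x}) := Finset.disjoint_left.2 fun w hw hw' => by
      simp at hw hw'
      exact hxZ (hw'.2 ▸ hw.2)
    have h3 := hvT ((U ∩ Z) ∪ (U ∩ {x})) (by intro w; simp; tauto) (by simp; tauto)
    rw [edgeCount_union hdx, Finset.card_union_of_disjoint hdx] at h3
    have h4 : (U ∩ {x}).card ≤ 1 := (Finset.card_le_card Finset.inter_subset_right).trans (by simp)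
    rcases (U ∩ R).eq_empty_or_nonempty with hUR | hUR
    · have hUx : U ∩ {x} = ∅ := by
        rw [← Finset.subset_empty, ← hUR]
        exact Finset.inter_subset_inter_left (by simpa using hxR)
      rw [hUx] at h3 he
      rw [hUR] at he hc
      simp [edgeCount_empty, crossCount] at h3 he hc
      omega
    · have := hmono _ Finset.inter_subset_right hUR
      omega
  · obtain ⟨A, B, C, rfl, hAB, hAC, hBC, hA, hB, hC, tAB, tAC, tBC, hxA⟩ :=
      hR.exists_triangle hxR hRe.ge
    obtain ⟨b, hb⟩ := hB.1
    obtain ⟨c, hc⟩ := hC.1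
    have hbZ : b ∉ Z := (hmR b).1 (by simp [hb])
    have hcZ : c ∉ Z := (hmR c).1 (by simp [hc])
    have hbx : b ≠ x := fun h => Finset.disjoint_left.1 hAB hxA (h ▸ hb)
    have hcx : c ≠ x := fun h => Finset.disjoint_left.1 hAC hxA (h ▸ hc)
    have hbc : b ≠ c := fun h => Finset.disjoint_left.1 hBC hb (h ▸ hc)
    by_cases hu : Z ∪ {x, b, c} = Finset.univ
    · have hmem : ∀ v, v ∉ Z → v = x ∨ v = b ∨ v = c := fun v hv => by
        have := Finset.mem_univ v
        rw [← hu] at this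
        simpa [hv] using this
      have hZe : Finset.univ \ {x, b, c} = Z := by
        ext v
        have := hmem v
        simp only [Finset.mem_sdiff, Finset.mem_univ, true_and, Finset.mem_insert,
          Finset.mem_singleton]
        grind
      have hAe : ∀ v ∈ A, v = x := fun v hv => by
        rcases hmem v ((hmR v).1 (by simp [hv])) with h | h | h
        · exact h
        · exact absurd (h ▸ hb) (Finset.disjoint_left.1 hAB hv)
        · exact absurd (h ▸ hc) (Finset.disjoint_left.1 hAC hv)
      have hBe : ∀ v ∈ B, v = b := fun v hv => by
        rcases hmem v ((hmR v).1 (by simp [hv])) with h | h | h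
        · exact absurd hv (Finset.disjoint_left.1 hAB (h ▸ hxA))
        · exact h
        · exact absurd (h ▸ hc) (Finset.disjoint_left.1 hBC hv)
      have hCe : ∀ v ∈ C, v = c := fun v hv => by
        rcases hmem v ((hmR v).1 (by simp [hv])) with h | h | h
        · exact absurd hv (Finset.disjoint_left.1 hAC (h ▸ hxA))
        · exact absurd hv (Finset.disjoint_left.1 hBC (h ▸ hb))
        · exact h
      refine ⟨b, c, ⟨?_, ?_, ?_, fun w hw => ?_, fun w hw => ?_⟩, by rw [hZe]; exact hZ.2.1,
        by rwa [hZe]⟩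
      · obtain ⟨p, hp, q, hq, h⟩ := tAB
        rwa [hAe p hp, hBe q hq] at h
      · obtain ⟨p, hp, q, hq, h⟩ := tAC
        rwa [hAe p hp, hCe q hq] at h
      · obtain ⟨p, hp, q, hq, h⟩ := tBC
        rwa [hBe p hp, hCe q hq] at h
      · by_cases hwZ : w ∈ Z
        · exact absurd (hZR w hwZ b hbZ hw.symm) hbx
        · rcases hmem w hwZ with h | rfl | h
          · exact Or.inl h
          · exact absurd hw (G.irrefl)
          · exact Or.inr h
      · by_cases hwZ : w ∈ Z
        · exact absurd (hZR w hwZ c hcZ hw.symm) hcx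
        · rcases hmem w hwZ with h | h | rfl
          · exact Or.inl h
          · exact Or.inr h
          · exact absurd hw (G.irrefl)
    · exfalso
      let K : SimpleGraph V := SimpleGraph.fromRel fun u w =>
        (G.Adj u w ∧ u ∈ Z ∧ (w ∈ Z ∨ w = x)) ∨ (u ∈ ({x, b, c} : Finset V) ∧ w ∈ ({x, b, c} : Finset V))
      have hKZ : ∀ u ∈ Z, ∀ w ∈ insert x Z, (G.Adj u w ↔ K.Adj u w) := by
        intro u hu w hw
        simp only [K, SimpleGraph.fromRel_adj, Finset.mem_insert, Finset.mem_singleton] at hw ⊢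
        have := G.ne_of_adj (a := u) (b := w)
        have := G.adj_comm u w
        grind
      have hKt : ∀ u ∈ ({x, b, c} : Finset V), ∀ w ∈ ({x, b, c} : Finset V), u ≠ w → K.Adj u w :=
        fun u hu w hw huw => (SimpleGraph.fromRel_adj _ _ _).2 ⟨huw, Or.inl (Or.inr ⟨hu, hw⟩)⟩
      have hminor : IsMinorOf (K.induce ((Z ∪ {x, b, c} : Finset V) : Set V)) G := by
        have hF : ∀ w ∈ Z ∪ {x, b, c}, w ∈ Z ∨ w = x ∨ w = b ∨ w = c := fun w hw => by
          simpa only [Finset.mem_union, Finset.mem_insert, Finset.mem_singleton] using hw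
        simp only [Finset.disjoint_union_right] at hZRd
        have hZA := fun w (hw : w ∈ Z) => Finset.disjoint_left.1 hZRd.1.1 hw
        have hZB := fun w (hw : w ∈ Z) => Finset.disjoint_left.1 hZRd.1.2 hw
        have hZC := fun w (hw : w ∈ Z) => Finset.disjoint_left.1 hZRd.2 hw
        let F : V → Finset V := fun w =>
          if w ∈ Z then {w} else if w = b then B else if w = c then C else A
        have FZ : ∀ w ∈ Z, F w = {w} := fun w hw => if_pos hw
        have Fx : F x = A := by simp [F, hxZ, hbx.symm, hcx.symm]
        have Fb : F b = B := by simp [F, hbZ]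
        have Fc : F c = C := by simp [F, hcZ, hbc.symm]
        clear_value F
        have hZx : ∀ w ∈ Z, K.Adj w x → Touch G {w} A := fun w hw h =>
          touch_of_adj (Finset.mem_singleton_self w) hxA ((hKZ w hw x (by simp)).2 h)
        have hZn : ∀ w ∈ Z, ∀ y ∉ Z, y ≠ x → ¬ K.Adj w y := fun w hw y hy hyx h => by
          simp only [K, SimpleGraph.fromRel_adj, Finset.mem_insert, Finset.mem_singleton] at h
          grind
        refine isMinorOf_induce_of_branch F (fun w hw => ?_) (fun w hw w' hw' hne => ?_)
          fun w hw w' hw' h => ?_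
        · rcases hF w hw with h | rfl | rfl | rfl
          · rw [FZ w h]; exact conn_singleton w
          · rwa [Fx]
          · rwa [Fb]
          · rwa [Fc]
        · rcases hF w hw with h | rfl | rfl | rfl <;> rcases hF w' hw' with h' | rfl | rfl | rfl <;>
            first
              | exact absurd rfl hne
              | simp [hAB.symm, hAC.symm, hBC.symm, *]
        · have hK := h.symm
          rcases hF w hw with h₀ | rfl | rfl | rfl <;> rcases hF w' hw' with h' | rfl | rfl | rfl
          · rw [FZ _ h₀, FZ _ h']
            exact touch_of_adj (Finset.mem_singleton_self _) (Finset.mem_singleton_self _)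
              ((hKZ _ h₀ _ (by simp [h'])).2 h)
          · rw [FZ _ h₀, Fx]; exact hZx _ h₀ h
          · exact absurd h (hZn _ h₀ _ hbZ hbx)
          · exact absurd h (hZn _ h₀ _ hcZ hcx)
          · rw [FZ _ h', Fx]; exact (hZx _ h' hK).symm
          · exact absurd h (K.irrefl)
          · rwa [Fx, Fb]
          · rwa [Fx, Fc]
          · exact absurd hK (hZn _ h' _ hbZ hbx)
          · rw [Fb, Fx]; exact tAB.symm
          · exact absurd h (K.irrefl)
          · rwa [Fb, Fc]
          · exact absurd hK (hZn _ h' _ hcZ hcx)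
          · rw [Fc, Fx]; exact tAC.symm
          · rw [Fc, Fb]; exact tBC.symm
          · exact absurd h (K.irrefl)
      obtain ⟨v, hv, hvT⟩ := h1.exists_apex ⟨x, by simp⟩ hu hminor
      have hKe : ∀ P ⊆ Z, edgeCount K P = edgeCount G P := fun P hP => by
        unfold edgeCount
        rw [← crossCount_congr fun u hu w hw => hKZ u (hP hu) w (Finset.mem_insert_of_mem (hP hw))]
      have hvZ : v ∈ Z := by
        by_contra hvZ
        have := hvT Z Finset.subset_union_left hvZ
        rw [hKe Z subset_rfl] at this
        omega
      obtain ⟨U, hvU, hU⟩ := h1.exists_dense v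
      obtain ⟨hcU, heU⟩ := hsplit U
      have hUR : edgeCount G (U ∩ (A ∪ B ∪ C)) ≤ (U ∩ (A ∪ B ∪ C)).card := by
        rcases (U ∩ (A ∪ B ∪ C)).eq_empty_or_nonempty with h | h
        · rw [h, edgeCount_empty]
          simp
        · have := hmono _ Finset.inter_subset_right h
          omega
      by_cases hxU : x ∈ U
      · rw [Finset.inter_singleton_of_mem hxU] at heU
        have hdt : Disjoint (U ∩ Z) {x, b, c} := by
          simp [hxZ, hbZ, hcZ]
        have h3 := hvT ((U ∩ Z) ∪ {x, b, c})
          (Finset.union_subset_union_left Finset.inter_subset_right)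
          (by simp [hvU]; grind)
        have h4 : edgeCount K {x, b, c} = 3 := by
          rw [edgeCount_insert (by simp [hbx.symm, hcx.symm]), edgeCount_insert (by simpa using hbc),
            edgeCount_singleton]
          have e1 := hKt x (by simp) b (by simp) hbx.symm
          have e2 := hKt x (by simp) c (by simp) hcx.symm
          have e3 := hKt b (by simp) c (by simp) hbc
          rw [Finset.insert_eq, crossCount_union_right (by simpa using hbc)]
          simp only [crossCount, Finset.sum_singleton, if_pos e1, if_pos e2, if_pos e3]
        have h5 : ({x, b, c} : Finset V).card = 3 := by
          rw [Finset.card_eq_three]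
          exact ⟨x, b, c, hbx.symm, hcx.symm, hbc, rfl⟩
        rw [edgeCount_union hdt, Finset.card_union_of_disjoint hdt, h4, h5,
          hKe _ Finset.inter_subset_right] at h3
        have h6 := crossCount_mono_right (G := K) (A := U ∩ Z) (B := {x}) (C := {x, b, c}) (by simp)
        rw [← crossCount_congr (G := G) fun u hu w hw => hKZ u (Finset.mem_inter.1 hu).2 w
          (by rw [Finset.mem_singleton.1 hw]; exact Finset.mem_insert_self _ _)] at h6
        omega
      · rw [Finset.inter_singleton_of_notMem hxU] at heU
        have h3 := hvT (U ∩ Z) (Finset.inter_subset_right.trans Finset.subset_union_left)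
          (by simp [hvU])
        rw [hKe _ Finset.inter_subset_right] at h3
        have h4 : crossCount G (U ∩ Z) ∅ = 0 := by simp [crossCount]
        omega

end Pendant

section Cores

variable {V : Type} [DecidableEq V] {G : SimpleGraph V}

/-- A connected subset of `H` that contains the root `x`. -/
def Rooted (G : SimpleGraph V) (H : Finset V) (x : V) (X : Finset V) : Prop :=
  X ⊆ H ∧ Conn G X ∧ x ∈ X

/-- The tips of two triangles pendent at different vertices, outside the set `H`. -/
structure TwoPendant (G : SimpleGraph V) (H : Finset V) (x b c y b' c' : V) : Prop where
  left : PendantTriangle G x b c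
  right : PendantTriangle G y b' c'
  nodup : [b, c, b', c'].Nodup
  tips : b ∉ H ∧ c ∉ H ∧ b' ∉ H ∧ c' ∉ H

variable {H : Finset V} {x b c y b' c' : V}

omit [DecidableEq V] in
theorem TwoPendant.swap (h : TwoPendant G H x b c y b' c') : TwoPendant G H y b' c' x b c :=
  ⟨h.right, h.left, by have := h.nodup; simp at this ⊢; grind,
    by have := h.tips; tauto⟩

omit [DecidableEq V] in
/-- The touching relations among the branch sets of two rooted sets and the pendent tips. -/
theorem TwoPendant.touch (h : TwoPendant G H x b c y b' c') {X Y : Finset V}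
    (hx : x ∈ X) (hy : y ∈ Y) :
    Touch G {b} {c} ∧ Touch G {b} X ∧ Touch G {c} X ∧
      Touch G {b'} {c'} ∧ Touch G Y {b'} ∧ Touch G Y {c'} :=
  ⟨touch_of_adj (by simp) (by simp) h.left.2.2.1, touch_of_adj (by simp) hx h.left.1.symm,
    touch_of_adj (by simp) hx h.left.2.1.symm, touch_of_adj (by simp) (by simp) h.right.2.2.1,
    touch_of_adj hy (by simp) h.right.1, touch_of_adj hy (by simp) h.right.2.1⟩

variable (h1 : ObsApexPseudoforest G) (h2 : ¬ InO G)
include h1 h2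

theorem TwoPendant.no_diamond_between (h : TwoPendant G H x b c y b' c') {X A B Y : Finset V}
    (hX : Rooted G H x X) (hY : Rooted G H y Y) (hAH : A ⊆ H) (hBH : B ⊆ H) (hA : Conn G A)
    (hB : Conn G B) (hd : [X, A, B, Y].Pairwise Disjoint) (tXA : Touch G X A)
    (tXB : Touch G X B) (tAB : Touch G A B) (tAY : Touch G A Y) (tBY : Touch G B Y) : False := by
  obtain ⟨hXH, hXc, hx⟩ := hX
  obtain ⟨hYH, hYc, hy⟩ := hY
  obtain ⟨hb, hc, hb', hc'⟩ := h.tips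
  have hn := h.nodup
  obtain ⟨t1, t2, t3, t4, t5, t6⟩ := h.touch hx hy
  refine h1.not_isMinorOf h2 (by simp [OList]) not_apexPseudoforest_O4
    (Model.isMinorOf (L := [{b}, {c}, X, A, B, Y, {b'}, {c'}]) ⟨?_, ?_, ?_⟩ rfl)
  · simp at hd hn ⊢
    grind
  · simp [conn_singleton, *]
  · simp [*]

theorem TwoPendant.no_two_triangles_between (h : TwoPendant G H x b c y b' c')
    {X A P B Y : Finset V} (hX : Rooted G H x X) (hY : Rooted G H y Y) (hAH : A ⊆ H)
    (hPH : P ⊆ H) (hBH : B ⊆ H) (hA : Conn G A) (hP : Conn G P) (hB : Conn G B)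
    (hd : [X, A, P, B, Y].Pairwise Disjoint) (tXA : Touch G X A) (tXP : Touch G X P)
    (tAP : Touch G A P) (tPB : Touch G P B) (tPY : Touch G P Y) (tBY : Touch G B Y)
    (tXY : Touch G X Y) : False := by
  obtain ⟨hXH, hXc, hx⟩ := hX
  obtain ⟨hYH, hYc, hy⟩ := hY
  obtain ⟨hb, hc, hb', hc'⟩ := h.tips
  have hn := h.nodup
  obtain ⟨t1, t2, t3, t4, t5, t6⟩ := h.touch hx hy
  refine h1.not_isMinorOf h2 (by simp [OList]) not_apexPseudoforest_O15
    (Model.isMinorOf (L := [{b}, {c}, X, A, P, B, Y, {b'}, {c'}]) ⟨?_, ?_, ?_⟩ rfl)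
  · simp at hd hn ⊢
    grind
  · simp [conn_singleton, *]
  · simp [*]

theorem TwoPendant.no_triangle_beside (h : TwoPendant G H x b c y b' c')
    {X Y A P B : Finset V} (hX : Rooted G H x X) (hY : Rooted G H y Y) (hAH : A ⊆ H)
    (hPH : P ⊆ H) (hBH : B ⊆ H) (hA : Conn G A) (hP : Conn G P) (hB : Conn G B)
    (hd : [X, Y, A, P, B].Pairwise Disjoint) (tXY : Touch G X Y) (tXP : Touch G X P)
    (tYA : Touch G Y A) (tAP : Touch G A P) (tAB : Touch G A B) (tPB : Touch G P B) :
    False := by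
  obtain ⟨hXH, hXc, hx⟩ := hX
  obtain ⟨hYH, hYc, hy⟩ := hY
  obtain ⟨hb, hc, hb', hc'⟩ := h.tips
  have hn := h.nodup
  obtain ⟨t1, t2, t3, t4, t5, t6⟩ := h.touch hx hy
  refine h1.not_isMinorOf h2 (by simp [OList]) not_apexPseudoforest_O12
    (Model.isMinorOf (L := [{b}, {c}, X, Y, {b'}, {c'}, A, P, B]) ⟨?_, ?_, ?_⟩ rfl)
  · simp at hd hn ⊢
    grind
  · simp [conn_singleton, *]
  · simp [*]

theorem TwoPendant.no_three_pendant (h : TwoPendant G H x b c y b' c') {z b'' c'' : V}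
    (h' : TwoPendant G H x b c z b'' c'') (hn' : [b', c', b'', c''].Nodup)
    {X Y Z : Finset V} (hX : Rooted G H x X) (hY : Rooted G H y Y) (hZ : Rooted G H z Z)
    (hd : [X, Y, Z].Pairwise Disjoint) (tXY : Touch G X Y) (tXZ : Touch G X Z)
    (tYZ : Touch G Y Z) : False := by
  obtain ⟨hXH, hXc, hx⟩ := hX
  obtain ⟨hYH, hYc, hy⟩ := hY
  obtain ⟨hZH, hZc, hz⟩ := hZ
  obtain ⟨hb, hc, hb', hc'⟩ := h.tips
  obtain ⟨-, -, hb'', hc''⟩ := h'.tips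
  have hn := h.nodup
  have hn₂ := h'.nodup
  obtain ⟨t1, t2, t3, t4, t5, t6⟩ := h.touch hx hy
  obtain ⟨-, -, -, t7, t8, t9⟩ := h'.touch hx hz
  refine h1.not_isMinorOf h2 (by simp [OList]) not_apexPseudoforest_O13
    (Model.isMinorOf (L := [{b}, {c}, X, Y, {b'}, {c'}, {b''}, {c''}, Z]) ⟨?_, ?_, ?_⟩ rfl)
  · simp at hd hn hn₂ hn' ⊢
    grind
  · simp [conn_singleton, *]
  · simp [*, t8.symm, t9.symm]

theorem TwoPendant.no_two_cycles (h : TwoPendant G H x b c y b' c') {X Y : Finset V}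
    (hX : X ⊆ H ∧ x ∈ X) (hY : Y ⊆ H ∧ y ∈ Y) (hd : Disjoint X Y)
    (hXe : X.card ≤ edgeCount G X) (hYe : Y.card ≤ edgeCount G Y) : False := by
  have key : ∀ {x b c : V} {X : Finset V}, PendantTriangle G x b c → b ≠ c → b ∉ X → c ∉ X →
      x ∈ X → X.card ≤ edgeCount G X → (X ∪ {b, c}).card < edgeCount G (X ∪ {b, c}) := by
    intro x b c X ht hbc hb hc hx he
    have hd : Disjoint X {b, c} := by simp [hb, hc]
    have e1 : crossCount G {b} {c} = 1 := by
      simp only [crossCount, Finset.sum_singleton, if_pos ht.2.2.1]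
    have e2 : 1 ≤ crossCount G X {b} :=
      crossCount_pos.2 (touch_of_adj hx (by simp) ht.1)
    have e3 : 1 ≤ crossCount G X {c} :=
      crossCount_pos.2 (touch_of_adj hx (by simp) ht.2.1)
    rw [edgeCount_union hd, Finset.card_union_of_disjoint hd, Finset.card_pair hbc,
      edgeCount_insert (by simpa using hbc), edgeCount_singleton, e1, Finset.insert_eq,
      crossCount_union_right (by simpa using hbc)]
    omega
  obtain ⟨hb, hc, hb', hc'⟩ := h.tips
  have hn := h.nodup
  simp at hn
  refine h1.not_disjoint_of_card_lt h2
    (key h.left hn.1.1 (fun h => hb (hX.1 h)) (fun h => hc (hX.1 h)) hX.2 hXe)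
    (key h.right hn.2.2 (fun h => hb' (hY.1 h)) (fun h => hc' (hY.1 h)) hY.2 hYe) ?_
  simp
  grind

end Cores

section TwoRoots

variable {V : Type} [DecidableEq V] {G : SimpleGraph V}

theorem Conn.exists_touching_triple {H : Finset V} (hH : Conn G H) {x y z : V} (hx : x ∈ H)
    (hy : y ∈ H) (hz : z ∈ H) (hxy : x ≠ y) (hxz : x ≠ z) (hyz : y ≠ z)
    (hK : ∀ v ∈ H, ∃ K ⊆ H, v ∉ K ∧ Conn G K ∧
      (x ≠ v → x ∈ K) ∧ (y ≠ v → y ∈ K) ∧ (z ≠ v → z ∈ K)) :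
    ∃ X Y Z, Rooted G H x X ∧ Rooted G H y Y ∧ Rooted G H z Z ∧ [X, Y, Z].Pairwise Disjoint ∧
      Touch G X Y ∧ Touch G X Z ∧ Touch G Y Z := by
  classical
  obtain ⟨X, hX, hmax⟩ := (H.powerset.filter fun X => Conn G X ∧ x ∈ X ∧ y ∉ X ∧ z ∉ X ∧
    Conn G (H \ X)).exists_max_image Finset.card (by
      obtain ⟨K, hKH, hxK, hKc, -, hyK, hzK⟩ := hK x hx
      obtain ⟨C, hC, hKC⟩ := exists_isComp (G := G) (S := H \ {x}) hKc
        fun v hv => by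
          rw [Finset.mem_sdiff, Finset.mem_singleton]
          exact ⟨hKH hv, fun h => hxK (h ▸ hv)⟩
      have hCH : C ⊆ H := hC.1.trans Finset.sdiff_subset
      have hxC : x ∉ C := fun h => by simpa using hC.1 h
      refine ⟨H \ C, ?_⟩
      simp only [Finset.mem_filter, Finset.mem_powerset, Finset.mem_sdiff, not_and, not_not]
      refine ⟨Finset.sdiff_subset, hH.sdiff_comp (conn_singleton x) (by simpa using hx) hC,
        ⟨hx, hxC⟩, fun _ => hKC (hyK hxy.symm), fun _ => hKC (hzK hxz.symm), ?_⟩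
      rw [Finset.sdiff_sdiff_eq_self hCH]
      exact hC.2.1)
  simp only [Finset.mem_filter, Finset.mem_powerset, and_imp] at hX hmax
  obtain ⟨hXH, hXc, hxX, hyX, hzX, hY⟩ := hX
  have hyY : y ∈ H \ X := by simp [hy, hyX]
  have hzY : z ∈ H \ X := by simp [hz, hzX]
  by_cases hv : ∃ v ∈ H \ X, v ≠ y ∧ v ≠ z ∧ Touch G X {v}
  · obtain ⟨v, hvY, hvy, hvz, tv⟩ := hv
    obtain ⟨T, hT, hyT⟩ := exists_isComp (G := G) (S := (H \ X) \ {v}) (conn_singleton y)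
      (by simp [hy, hyX, hvy.symm])
    rw [Finset.singleton_subset_iff] at hyT
    have hTY : T ⊆ H \ X := hT.1.trans Finset.sdiff_subset
    have hvT : v ∉ T := fun h => by simpa using hT.1 h
    have hYT := hY.sdiff_comp (conn_singleton v) (by simpa using hvY) hT
    have hvYT : v ∈ (H \ X) \ T := by rw [Finset.mem_sdiff]; exact ⟨hvY, hvT⟩
    have hsub : (H \ X) \ T ⊆ H := Finset.sdiff_subset.trans Finset.sdiff_subset
    have hzT : z ∉ T := by
      intro hzT
      have hc : H \ (X ∪ (H \ X) \ T) = T := by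
        ext w
        have := @hTY w
        simp only [Finset.mem_sdiff, Finset.mem_union] at *
        tauto
      have := hmax (X ∪ (H \ X) \ T) (Finset.union_subset hXH hsub)
        (hXc.union hYT (Or.inl (tv.mono subset_rfl (by simpa using hvYT))))
        (by simp [hxX]) (by simp [hyX, hyT]) (by simp [hzX, hzT]) (by rw [hc]; exact hT.2.1)
      refine absurd this (not_le.2 (Finset.card_lt_card ⟨Finset.subset_union_left, fun h => ?_⟩))
      exact (Finset.mem_sdiff.1 hvY).2 (h (Finset.mem_union_right _ hvYT))
    refine ⟨X, T, (H \ X) \ T, ⟨hXH, hXc, hxX⟩, ⟨hTY.trans Finset.sdiff_subset, hT.2.1, hyT⟩,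
      ⟨hsub, hYT, by rw [Finset.mem_sdiff]; exact ⟨hzY, hzT⟩⟩, ?_, ?_,
      tv.mono subset_rfl (by simpa using hvYT),
      hY.touch hTY hT.2.1.1 (by rintro rfl; exact hvT hvY)⟩
    · simp only [List.pairwise_cons, List.mem_cons, List.not_mem_nil, or_false, forall_eq_or_imp,
        forall_eq, List.Pairwise.nil, and_true, IsEmpty.forall_iff, implies_true]
      exact ⟨⟨Finset.disjoint_sdiff.mono_right hTY,
        Finset.disjoint_sdiff.mono_right Finset.sdiff_subset⟩, Finset.disjoint_sdiff⟩
    · by_contra ht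
      obtain ⟨K, hKH, hvK, hKc, hxK, hyK, -⟩ := hK v (Finset.mem_sdiff.1 hvY).1
      have hxv : x ≠ v := fun h => (Finset.mem_sdiff.1 hvY).2 (h ▸ hxX)
      rcases hKc.subset_or (P := T) (Q := X ∪ ((H \ X) \ {v}) \ T) (fun w hw => by
        have := hKH hw
        simp only [Finset.mem_sdiff, Finset.mem_union, Finset.mem_singleton]
        grind) (by
        rintro ⟨s, hs, t, ht', hst⟩
        rcases Finset.mem_union.1 ht' with ht' | ht'
        · exact ht ⟨t, ht', s, hs, hst.symm⟩
        · exact hT.2.2 ⟨s, hs, t, ht', hst⟩) with h | h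
      · exact (Finset.mem_sdiff.1 (hTY (h (hxK hxv)))).2 hxX
      · have := h (hyK hvy.symm)
        simp [hyX, hyT] at this
  · push Not at hv
    have key : ∀ u w : V, u ∈ H \ X → w ∈ H \ X → u ≠ w →
        (∀ v ∈ H \ X, v ≠ u → v ≠ w → ¬ Touch G X {v}) →
        (∃ K ⊆ H, w ∉ K ∧ Conn G K ∧ x ∈ K ∧ u ∈ K) → Touch G X {u} := by
      rintro u w hu hw huw hn ⟨K, hKH, hwK, hKc, hxK, huK⟩
      obtain ⟨p, hp, q, hq, hpq⟩ := hKc.touch (P := K ∩ X) Finset.inter_subset_left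
        ⟨x, by simp [hxK, hxX]⟩ (by
          intro h
          rw [← h] at huK
          exact (Finset.mem_sdiff.1 hu).2 (Finset.mem_inter.1 huK).2)
      simp only [Finset.mem_inter, Finset.mem_sdiff, not_and] at hp hq
      have tq : Touch G X {q} := touch_of_adj hp.2 (by simp) hpq
      by_cases hqu : q = u
      · rwa [← hqu]
      · exact absurd tq (hn q (by simp [hKH hq.1, hq.2 hq.1]) hqu fun h => hwK (h ▸ hq.1))
    obtain ⟨K, hKH, hzK, hKc, hxK, hyK, -⟩ := hK z hz
    obtain ⟨K', hKH', hyK', hKc', hxK', -, hzK'⟩ := hK y hy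
    have ty := key y z hyY hzY hyz hv ⟨K, hKH, hzK, hKc, hxK hxz, hyK hyz⟩
    have tz := key z y hzY hyY hyz.symm (fun v hv' h h' => hv v hv' h' h)
      ⟨K', hKH', hyK', hKc', hxK' hxy, hzK' hyz.symm⟩
    obtain ⟨A, B, hAB, hu, hA, hB, hyA, hzB, tAB⟩ := hY.split hyY hzY hyz
    have hAY : A ⊆ H \ X := hu ▸ Finset.subset_union_left
    have hBY : B ⊆ H \ X := hu ▸ Finset.subset_union_right
    refine ⟨X, A, B, ⟨hXH, hXc, hxX⟩, ⟨hAY.trans Finset.sdiff_subset, hA, hyA⟩,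
      ⟨hBY.trans Finset.sdiff_subset, hB, hzB⟩, ?_, ty.mono subset_rfl (by simpa using hyA),
      tz.mono subset_rfl (by simpa using hzB), tAB⟩
    simp only [List.pairwise_cons, List.mem_cons, List.not_mem_nil, or_false, forall_eq_or_imp,
      forall_eq, List.Pairwise.nil, and_true, IsEmpty.forall_iff, implies_true]
    exact ⟨⟨Finset.disjoint_sdiff.mono_right hAY, Finset.disjoint_sdiff.mono_right hBY⟩, hAB⟩

/-- Split a connected set along two neighbours of `v`, with `y` in the first part. -/
theorem Conn.split_neighbors {T : Finset V} (hT : Conn G T) {v y : V} (hy : y ∈ T)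
    (hv : 2 ≤ crossCount G {v} T) : ∃ A B, Disjoint A B ∧ A ∪ B = T ∧ Conn G A ∧ Conn G B ∧
      y ∈ A ∧ Touch G {v} A ∧ Touch G {v} B ∧ Touch G A B := by
  obtain ⟨p, hp, q, hq, hpq, hvp, hvq⟩ := two_le_crossCount hv
  obtain ⟨A, B, hAB, rfl, hA, hB, hpA, hqB, tAB⟩ := hT.split hp hq hpq
  rcases Finset.mem_union.1 hy with hyA | hyB
  · exact ⟨A, B, hAB, rfl, hA, hB, hyA, touch_of_adj (by simp) hpA hvp,
      touch_of_adj (by simp) hqB hvq, tAB⟩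
  · exact ⟨B, A, hAB.symm, Finset.union_comm _ _, hB, hA, hyB, touch_of_adj (by simp) hqB hvq,
      touch_of_adj (by simp) hpA hvp, tAB.symm⟩

variable {H : Finset V} {x b c y b' c' : V}

theorem TwoPendant.lt_two_crossCount (h1 : ObsApexPseudoforest G) (h2 : ¬ InO G)
    (h : TwoPendant G H x b c y b' c') {X T : Finset V} {v : V} (hX : Rooted G H x X)
    (hT : Rooted G H y T) (hXT : Disjoint X T) (hvH : v ∈ H) (hvX : v ∉ X) (hvT : v ∉ T)
    (tXT : Touch G X T) (hdT : 2 ≤ crossCount G {v} T) : crossCount G {v} X < 2 := by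
  by_contra! hdX
  obtain ⟨hXH, hXc, hx⟩ := hX
  obtain ⟨hTH, hTc, hy⟩ := hT
  have hvH' : {v} ⊆ H := by simpa using hvH
  have tvX : Touch G {v} X := crossCount_pos.1 (by omega)
  have tvT : Touch G {v} T := crossCount_pos.1 (by omega)
  obtain ⟨A, B, hAB, rfl, hA, hB, hyA, tvA, tvB, tAB⟩ := hTc.split_neighbors hy hdT
  obtain ⟨C, D, hCD, rfl, hC, hD, hxC, tvC, tvD, tCD⟩ := hXc.split_neighbors hx hdX
  have hdj := hXT
  simp only [Finset.disjoint_union_left, Finset.disjoint_union_right] at hXT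
  rw [Finset.union_subset_iff] at hTH hXH
  rw [Finset.mem_union, not_or] at hvX hvT
  obtain ⟨a, ha, t, ht, hat⟩ := tXT
  rcases Finset.mem_union.1 ht with htA | htB
  · rcases Finset.mem_union.1 ha with haC | haD
    · exact h.no_two_triangles_between h1 h2 ⟨hXH.1, hC, hxC⟩ ⟨hTH.1, hA, hyA⟩ hXH.2 hvH' hTH.2
        hD (conn_singleton v) hB (by simp [*, disjoint_comm, hXT.1.1.symm, hXT.1.2.symm, hXT.2.1.symm, hXT.2.2.symm]) tCD tvC.symm
        tvD.symm tvB tvA tAB.symm (touch_of_adj haC htA hat)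
    · exact h.swap.no_diamond_between h1 h2 (X := A ∪ B) (A := {v}) (B := D) (Y := C)
        ⟨Finset.union_subset hTH.1 hTH.2, hTc, hy⟩ ⟨hXH.1, hC, hxC⟩ hvH' hXH.2 (conn_singleton v)
        hD (by simp [*, disjoint_comm, hXT.1.1.symm, hXT.1.2.symm, hXT.2.1.symm, hXT.2.2.symm]) tvT.symm (touch_of_adj haD ht hat).symm tvD tvC
        tCD.symm
  · exact h.no_diamond_between h1 h2 (X := C ∪ D) (A := {v}) (B := B) (Y := A)
      ⟨Finset.union_subset hXH.1 hXH.2, hXc, hx⟩ ⟨hTH.1, hA, hyA⟩ hvH' hTH.2 (conn_singleton v)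
      hB (by simp [*, disjoint_comm, hXT.1.1.symm, hXT.1.2.symm, hXT.2.1.symm, hXT.2.2.symm]) tvX.symm (touch_of_adj ha htB hat) tvB tvA
      tAB.symm

end TwoRoots

section TwoRootsMain

variable {V : Type} [DecidableEq V] {G : SimpleGraph V} {H : Finset V} {x b c y b' c' : V}

/-- A component of `T \ {y}` that sends two edges to `v` is impossible. -/
theorem TwoPendant.crossCount_comp_lt_two (h1 : ObsApexPseudoforest G) (h2 : ¬ InO G)
    (h : TwoPendant G H x b c y b' c') {X T : Finset V} {v : V} (hX : Rooted G H x X)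
    (hT : Rooted G H y T) (hXT : Disjoint X T) (hvH : v ∈ H) (hvX : v ∉ X) (hvT : v ∉ T)
    (hu : H ⊆ insert v (X ∪ T)) (hcut : ∀ w ∈ H, Conn G (H \ {w}))
    (tvX : Touch G {v} X) (tXT : Touch G X T) (heT : edgeCount G T < T.card)
    (hstar : ∀ S ⊆ T \ {y}, Conn G S → Conn G (T \ S) → Touch G S X → Touch G {v} S →
      ¬ Touch G {v} (T \ S))
    {S : Finset V} (hS : IsComp G (T \ {y}) S) : crossCount G {v} S < 2 := by
  by_contra! hd
  obtain ⟨hXH, hXc, hx⟩ := hX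
  obtain ⟨hTH, hTc, hy⟩ := hT
  have hST : S ⊆ T := hS.1.trans Finset.sdiff_subset
  have hyS : y ∉ S := fun h => by simpa using hS.1 h
  have hR := hTc.sdiff_comp (conn_singleton y) (by simpa using hy) hS
  have hyR : y ∈ T \ S := by simp [hy, hyS]
  have tvS : Touch G {v} S := crossCount_pos.1 (by omega)
  have tSR := hTc.touch hST hS.2.1.1 (by rintro rfl; exact hyS hy)
  have hTeq : S ∪ (T \ S) = T := Finset.union_sdiff_of_subset hST
  have hdj : Disjoint S (T \ S) := Finset.disjoint_sdiff
  have hcard := Finset.card_union_of_disjoint hdj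
  have hedge := edgeCount_union (G := G) hdj
  rw [hTeq] at hcard hedge
  by_cases tRX : Touch G (T \ S) X
  · obtain ⟨s, hs, t, ht, hst⟩ := tSR
    obtain ⟨A, B, hAB, rfl, hA, hB, hsA, tvA, tvB, tAB⟩ := hS.2.1.split_neighbors hs hd
    refine h.no_triangle_beside h1 h2 (X := X) (Y := T \ (A ∪ B)) (A := A) (P := {v}) (B := B)
      ⟨hXH, hXc, hx⟩ ⟨Finset.sdiff_subset.trans hTH, hR, hyR⟩
      (Finset.subset_union_left.trans (hST.trans hTH)) (by simpa using hvH)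
      (Finset.subset_union_right.trans (hST.trans hTH)) hA (conn_singleton v) hB ?_ tRX.symm
      tvX.symm (touch_of_adj hsA ht hst).symm tvA.symm tAB tvB
    have hvA : v ∉ A ∪ B := fun h => hvT (hST h)
    rw [Finset.mem_union, not_or] at hvA
    have e1 := hXT.mono_right hST
    rw [Finset.disjoint_union_right] at e1
    have e2 := hXT.mono_right (Finset.sdiff_subset (s := T) (t := A ∪ B))
    rw [Finset.disjoint_union_left] at hdj
    simp only [List.pairwise_cons, List.mem_cons, List.not_mem_nil, or_false, forall_eq_or_imp,
      forall_eq, List.Pairwise.nil, and_true, IsEmpty.forall_iff, implies_true,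
      Finset.disjoint_singleton_left, Finset.disjoint_singleton_right, Finset.mem_sdiff]
    exact ⟨⟨e2, e1.1, hvX, e1.2⟩, ⟨hdj.1.symm, fun h => hvT h.1, hdj.2.symm⟩, ⟨hvA.1, hAB⟩,
      hvA.2⟩
  · have tSX : Touch G S X := by
      obtain ⟨p, hp, q, hq, hpq⟩ := tXT
      rw [← hTeq, Finset.mem_union] at hq
      rcases hq with hq | hq
      · exact ⟨q, hq, p, hp, hpq.symm⟩
      · exact absurd ⟨q, hq, p, hp, hpq.symm⟩ tRX
    have hvR := hstar S hS.1 hS.2.1 hR tSX tvS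
    obtain ⟨s, hs, t, ht, hst⟩ := tSR
    have hsR : s ∉ T \ S := fun h => (Finset.mem_sdiff.1 h).2 hs
    obtain ⟨p, hp, q, hq, hpq⟩ := (hcut s (hTH (hST hs))).touch (P := T \ S) (fun w hw => by
        rw [Finset.mem_sdiff, Finset.mem_singleton]
        exact ⟨hTH (Finset.sdiff_subset hw), fun h => hsR (h ▸ hw)⟩) hR.1 (fun he => by
        have : x ∈ T \ S := by
          rw [he, Finset.mem_sdiff, Finset.mem_singleton]
          exact ⟨hXH hx, fun h => Finset.disjoint_left.1 hXT hx (h ▸ hST hs)⟩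
        exact Finset.disjoint_left.1 hXT hx (Finset.sdiff_subset this))
    have hqS : q ∈ S \ {s} := by
      have hqH := hu (Finset.mem_sdiff.1 (Finset.mem_sdiff.1 hq).1).1
      rw [Finset.mem_insert, Finset.mem_union] at hqH
      rcases hqH with rfl | hqX | hqT
      · exact absurd ⟨q, by simp, p, hp, hpq.symm⟩ hvR
      · exact absurd ⟨p, hp, q, hqX, hpq⟩ tRX
      · simp only [Finset.mem_sdiff, Finset.mem_singleton] at hq ⊢
        tauto
    have hc1 : 1 ≤ crossCount G (T \ S) {s} := crossCount_pos.2 ⟨t, ht, s, by simp, hst.symm⟩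
    have hc2 : 1 ≤ crossCount G (T \ S) (S \ {s}) := crossCount_pos.2 ⟨p, hp, q, hqS, hpq⟩
    have hc3 := crossCount_union_right (G := G) (A := {s}) (B := S \ {s}) (C := T \ S)
      Finset.disjoint_sdiff
    rw [Finset.union_sdiff_of_subset (by simpa using hs), crossCount_comm (T \ S) S] at hc3
    have := hS.2.1.card_le
    have := hR.card_le
    omega

theorem TwoPendant.false_of_partition (h1 : ObsApexPseudoforest G) (h2 : ¬ InO G)
    (h : TwoPendant G H x b c y b' c') {X T : Finset V} {v : V} (hX : Rooted G H x X)
    (hT : Rooted G H y T) (hXT : Disjoint X T) (hvH : v ∈ H) (hvX : v ∉ X) (hvT : v ∉ T)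
    (hu : H = insert v (X ∪ T)) (hcut : ∀ w ∈ H, Conn G (H \ {w}))
    (tvX : Touch G {v} X) (heT : edgeCount G T < T.card) (hdT : 2 ≤ crossCount G {v} T)
    (hey : (H \ {y}).card ≤ edgeCount G (H \ {y})) : False := by
  have tXT : Touch G X T := by
    have he : X ∪ T = H \ {v} := by
      ext w
      simp only [hu, Finset.mem_sdiff, Finset.mem_insert, Finset.mem_singleton, Finset.mem_union]
      grind
    exact (hcut v hvH).2 X T hX.2.1.1 hT.2.1.1 hXT he
  have hdX := h.lt_two_crossCount h1 h2 hX hT hXT hvH hvX hvT tXT hdT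
  have hstar : ∀ S ⊆ T \ {y}, Conn G S → Conn G (T \ S) → Touch G S X → Touch G {v} S →
      ¬ Touch G {v} (T \ S) := by
    intro S hS hSc hR tSX tvS tvR
    have hST : S ⊆ T := hS.trans Finset.sdiff_subset
    have hyS : y ∉ S := fun h => by simpa using hS h
    refine h.no_diamond_between h1 h2 (X := X) (A := {v}) (B := S) (Y := T \ S) hX
      ⟨Finset.sdiff_subset.trans hT.1, hR, by simp [hT.2.2, hyS]⟩ (by simpa using hvH)
      (hST.trans hT.1) (conn_singleton v) hSc ?_ tvX.symm tSX.symm tvS tvR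
      (hT.2.1.touch hST hSc.1 (by rintro rfl; exact hyS hT.2.2))
    simp only [List.pairwise_cons, List.mem_cons, List.not_mem_nil, or_false, forall_eq_or_imp,
      forall_eq, List.Pairwise.nil, and_true, IsEmpty.forall_iff, implies_true,
      Finset.disjoint_singleton_left, Finset.disjoint_singleton_right, Finset.mem_sdiff]
    exact ⟨⟨hvX, hXT.mono_right hST, hXT.mono_right Finset.sdiff_subset⟩,
      ⟨fun h => hvT (hST h), fun h => hvT h.1⟩, Finset.disjoint_sdiff⟩
  have hcomp : ∀ {S}, IsComp G (T \ {y}) S → crossCount G {v} S < 2 := fun hS =>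
    h.crossCount_comp_lt_two h1 h2 hX hT hXT hvH hvX hvT hu.le hcut tvX tXT heT hstar hS
  obtain ⟨hXH, hXc, hx⟩ := hX
  obtain ⟨hTH, hTc, hy⟩ := hT
  have hyX : y ∉ X := fun h => Finset.disjoint_left.1 hXT h hy
  have hyv : y ≠ v := fun h => hvT (h ▸ hy)
  have hvL : v ∉ X ∪ (T \ {y}) := by simp [hvX, hvT]
  have hHy : H \ {y} = insert v (X ∪ (T \ {y})) := by
    ext w
    simp only [hu, Finset.mem_sdiff, Finset.mem_insert, Finset.mem_singleton, Finset.mem_union]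
    grind
  rw [hHy, edgeCount_insert hvL, Finset.card_insert_of_notMem hvL] at hey
  obtain ⟨S, hS, hlt⟩ := exists_isComp_card_lt (G := G)
    (fun A => edgeCount G A + crossCount G {v} A) (by simp [edgeCount_empty, crossCount])
    (fun A B hd ht => by
      rw [edgeCount_union_of_not_touch hd ht, crossCount_union_right hd]
      omega) hey
  have hmL : ∀ w ∈ S, w ∈ X ∨ w ∈ T ∧ w ≠ y := fun w hw => by
    have := hS.1 hw
    simpa only [Finset.mem_union, Finset.mem_sdiff, Finset.mem_singleton] using this
  by_cases hSX : Disjoint X S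
  · have hST : S ⊆ T \ {y} := fun w hw => by
      rcases hmL w hw with h | h
      · exact absurd hw (Finset.disjoint_left.1 hSX h)
      · simpa using h
    have := hcomp ⟨hST, hS.2.1, fun ht => hS.2.2 (ht.mono subset_rfl
      (Finset.sdiff_subset_sdiff Finset.subset_union_right subset_rfl))⟩
    have := hTc.edgeCount_mono hS.2.1.1 (hST.trans Finset.sdiff_subset)
    omega
  · have hXS : X ⊆ S := hS.subset_of_conn hXc Finset.subset_union_left hSX
    have hU : S ∩ T ⊆ T \ {y} := fun w hw => by
      rw [Finset.mem_inter] at hw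
      have := hmL w hw.1
      simp only [Finset.mem_sdiff, Finset.mem_singleton]
      exact ⟨hw.2, fun h => by subst h; tauto⟩
    have hSeq : S = X ∪ (S ∩ T) := by
      ext w
      have := hmL w
      have := @hXS w
      simp only [Finset.mem_union, Finset.mem_inter]
      tauto
    have hvU : crossCount G {v} (S ∩ T) = 0 := by
      rw [crossCount_eq_zero]
      rintro ⟨v', hv', u, hu', hvu⟩
      rw [Finset.mem_singleton] at hv'
      subst hv'
      obtain ⟨S', hS', huS'⟩ := exists_isComp (G := G) (S := T \ {y}) (conn_singleton u)
        (by simpa using hU hu')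
      rw [Finset.singleton_subset_iff] at huS'
      have hS'T : S' ⊆ T := hS'.1.trans Finset.sdiff_subset
      have hS'S : S' ⊆ S := hS.subset_of_conn hS'.2.1
        (hS'.1.trans Finset.subset_union_right) (by
          rw [Finset.not_disjoint_iff]
          exact ⟨u, huS', (Finset.mem_inter.1 hu').1⟩)
      have tS'X : Touch G S' X := by
        obtain ⟨p, hp, q, hq, hpq⟩ := hS.2.1.touch hS'S hS'.2.1.1 (by
          rintro rfl
          exact Finset.disjoint_left.1 hXT hx (hS'T (hXS hx)))
        rw [Finset.mem_sdiff] at hq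
        rcases hmL q hq.1 with h | h
        · exact ⟨p, hp, q, h, hpq⟩
        · exact absurd ⟨p, hp, q, by simp [h, hq.2], hpq⟩ hS'.2.2
      have hn := hstar S' hS'.1 hS'.2.1
        (hTc.sdiff_comp (conn_singleton y) (by simpa using hy) hS') tS'X
        (touch_of_adj (by simp) huS' hvu)
      have h0 := crossCount_union_right (G := G) (C := {v'})
        (Finset.disjoint_sdiff (s := S') (t := T))
      rw [Finset.union_sdiff_of_subset hS'T, crossCount_eq_zero.2 hn] at h0
      have := hcomp hS'
      omega
    have hdXU : Disjoint X (S ∩ T) := hXT.mono_right Finset.inter_subset_right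
    have hvS : crossCount G {v} S = crossCount G {v} X := by
      rw [hSeq, crossCount_union_right hdXU, hvU, add_zero]
    have hR : Conn G (T \ (S ∩ T)) := hTc.sdiff (conn_singleton y) (by simpa using hy) hU
      fun ht => hS.2.2 (ht.mono Finset.inter_subset_left fun w hw => by
        simp only [Finset.mem_sdiff, Finset.mem_inter, Finset.mem_union] at hw ⊢
        tauto)
    have hvR : crossCount G {v} (T \ (S ∩ T)) = crossCount G {v} T := by
      have := crossCount_union_right (G := G) (C := {v})
        (Finset.disjoint_sdiff (s := S ∩ T) (t := T))
      rw [Finset.union_sdiff_of_subset Finset.inter_subset_right, hvU] at this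
      omega
    have hvR' : v ∉ T \ (S ∩ T) := fun h => hvT (Finset.sdiff_subset h)
    refine h.no_two_cycles h1 h2 (X := S) (Y := insert v (T \ (S ∩ T))) ⟨?_, hXS hx⟩ ⟨?_, ?_⟩ ?_
      (by omega) ?_
    · intro w hw
      rcases hmL w hw with h | h
      · exact hXH h
      · exact hTH h.1
    · exact Finset.insert_subset hvH (Finset.sdiff_subset.trans hTH)
    · have : y ∉ S := fun h => by
        have := hmL y h
        tauto
      simp [hy, this]
    · rw [Finset.disjoint_insert_right]
      refine ⟨fun h => hvL (hS.1 h), Finset.disjoint_left.2 fun w hw hw' => ?_⟩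
      simp [hw] at hw'
    · rw [edgeCount_insert hvR', Finset.card_insert_of_notMem hvR', hvR]
      have := hR.card_le
      omega

/-- Two pendent triangles cannot be attached to a 2-connected set that keeps a cycle after the
removal of either root. -/
theorem TwoPendant.false_of_conn_sdiff (h1 : ObsApexPseudoforest G) (h2 : ¬ InO G)
    (h : TwoPendant G H x b c y b' c') (hx : x ∈ H) (hy : y ∈ H) (hxy : x ≠ y)
    (hcut : ∀ w ∈ H, Conn G (H \ {w}))
    (hex : (H \ {x}).card ≤ edgeCount G (H \ {x}))
    (hey : (H \ {y}).card ≤ edgeCount G (H \ {y})) : False := by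
  classical
  obtain ⟨X, hX, hmax⟩ := (H.powerset.filter fun X => Conn G X ∧ x ∈ X ∧ y ∉ X ∧
    Conn G (H \ X) ∧ (H \ X).card ≤ edgeCount G (H \ X)).exists_max_image Finset.card
      ⟨{x}, by simp [hx, hxy.symm, conn_singleton, hcut, hex]⟩
  simp only [Finset.mem_filter, Finset.mem_powerset, and_imp] at hX hmax
  obtain ⟨hXH, hXc, hxX, hyX, hY, hYe⟩ := hX
  have hyY : y ∈ H \ X := by simp [hy, hyX]
  obtain ⟨a, ha, v₀, hv₀, hav⟩ := (hcut y hy).touch (P := X) (fun w hw => by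
    rw [Finset.mem_sdiff, Finset.mem_singleton]
    exact ⟨hXH hw, fun h => hyX (h ▸ hw)⟩) hXc.1 (by
      intro he
      have : H \ X = {y} := by
        rw [he, Finset.sdiff_sdiff_eq_self (by simpa using hy)]
      rw [this, edgeCount_singleton] at hYe
      simp at hYe)
  simp only [Finset.mem_sdiff, Finset.mem_singleton] at hv₀
  obtain ⟨⟨v, T⟩, hvT, hTmax⟩ := ((H ×ˢ H.powerset).filter fun p : V × Finset V =>
    p.1 ∈ H \ X ∧ p.1 ≠ y ∧ Touch G {p.1} X ∧ Conn G p.2 ∧ y ∈ p.2 ∧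
      p.2 ⊆ (H \ X) \ {p.1}).exists_max_image (fun p => p.2.card) ⟨(v₀, {y}), by
        simp only [Finset.mem_filter, Finset.mem_product, Finset.mem_powerset,
          Finset.singleton_subset_iff, Finset.mem_sdiff, Finset.mem_singleton]
        exact ⟨⟨hv₀.1.1, hy⟩, ⟨hv₀.1.1, hv₀.2⟩, hv₀.1.2, touch_of_adj (by simp) ha hav.symm,
          conn_singleton y, trivial, ⟨hy, hyX⟩, Ne.symm hv₀.1.2⟩⟩
  simp only [Finset.mem_filter, Finset.mem_product, Finset.mem_powerset, and_imp,
    Prod.forall] at hvT hTmax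
  obtain ⟨⟨hvH, hTH⟩, hvY, hvy, tvX, hTc, hyT, hTY⟩ := hvT
  have hvX := (Finset.mem_sdiff.1 hvY).2
  have hTm : ∀ w ∈ T, w ∈ H ∧ w ∉ X ∧ w ≠ v := fun w hw => by
    have := hTY hw
    simp only [Finset.mem_sdiff, Finset.mem_singleton] at this
    tauto
  have hvT : v ∉ T := fun h => (hTm v h).2.2 rfl
  have hXT : Disjoint X T := Finset.disjoint_right.2 fun w hw => (hTm w hw).2.1
  have hTeq : (H \ X) \ {v} ⊆ T := by
    by_contra hne
    obtain ⟨l, hl, hlT⟩ := Finset.not_subset.1 hne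
    have hTL : ¬ Touch G T (((H \ X) \ {v}) \ T) := by
      rintro ⟨t, ht, w, hw, htw⟩
      rw [Finset.mem_sdiff] at hw
      have := hTmax v (insert w T) hvH (Finset.insert_subset
        (Finset.sdiff_subset (Finset.sdiff_subset hw.1)) hTH) hvY hvy tvX
        (hTc.insert_vertex (touch_of_adj (by simp) ht htw.symm)) (by simp [hyT])
        (Finset.insert_subset hw.1 hTY)
      rw [Finset.card_insert_of_notMem hw.2] at this
      omega
    obtain ⟨w, hw, p, hp, hwp⟩ := (hcut v hvH).touch (P := ((H \ X) \ {v}) \ T) (fun w hw => by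
      simp only [Finset.mem_sdiff] at hw ⊢
      tauto) ⟨l, by rw [Finset.mem_sdiff]; exact ⟨hl, hlT⟩⟩ (by
        intro he
        have : x ∈ H \ {v} := by
          rw [Finset.mem_sdiff, Finset.mem_singleton]
          exact ⟨hx, fun h => hvX (h ▸ hxX)⟩
        rw [← he] at this
        simp [hxX] at this)
    have hpX : p ∈ X := by
      by_contra hpX
      refine hTL ⟨p, ?_, w, hw, hwp.symm⟩
      simp only [Finset.mem_sdiff] at hp
      tauto
    have tvT : Touch G {v} T := by
      obtain ⟨t, ht, q, hq, htq⟩ := hY.touch (P := T) (hTY.trans Finset.sdiff_subset) hTc.1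
        (by rintro rfl; exact hvT hvY)
      by_cases hqv : q = v
      · subst hqv
        exact touch_of_adj (by simp) ht htq.symm
      · exact absurd ⟨t, ht, q, by simp_all, htq⟩ hTL
    have hw' := hw
    simp only [Finset.mem_sdiff, Finset.mem_singleton] at hw'
    have hwy : w ≠ y := by rintro rfl; exact hw'.2 hyT
    have := hTmax w (insert v T) hw'.1.1.1 (Finset.insert_subset hvH hTH)
      (Finset.mem_sdiff.2 hw'.1.1) hwy (touch_of_adj (by simp) hpX hwp)
      (hTc.insert_vertex tvT) (by simp [hyT]) (fun u hu => by
        rw [Finset.mem_insert] at hu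
        simp only [Finset.mem_sdiff, Finset.mem_singleton]
        rcases hu with rfl | hu
        · exact ⟨⟨hvH, hvX⟩, fun h => hw'.1.2 h.symm⟩
        · exact ⟨⟨(hTm u hu).1, (hTm u hu).2.1⟩, fun h => hw'.2 (h ▸ hu)⟩)
    rw [Finset.card_insert_of_notMem hvT] at this
    omega
  have hYeq : H \ X = insert v T := by
    ext w
    have := @hTeq w
    have := hTm w
    simp only [Finset.mem_sdiff, Finset.mem_singleton, Finset.mem_insert] at *
    grind
  have heT : edgeCount G T < T.card := by
    by_contra! he
    have hc : H \ insert v X = T := by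
      ext w
      have := Finset.ext_iff.1 hYeq w
      have := hTm w
      simp only [Finset.mem_sdiff, Finset.mem_insert] at *
      grind
    have := hmax (insert v X) (Finset.insert_subset hvH hXH) (hXc.insert_vertex tvX)
      (by simp [hxX]) (by simp [hyX, hvy.symm]) (by rwa [hc]) (by rwa [hc])
    rw [Finset.card_insert_of_notMem hvX] at this
    omega
  refine h.false_of_partition h1 h2 ⟨hXH, hXc, hxX⟩ ⟨hTH, hTc, hyT⟩ hXT hvH hvX hvT ?_ hcut tvX
    heT ?_ hey
  · ext w
    have := Finset.ext_iff.1 hYeq w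
    have := @hXH w
    simp only [Finset.mem_sdiff, Finset.mem_insert, Finset.mem_union] at *
    grind
  · rw [hYeq, edgeCount_insert hvT, Finset.card_insert_of_notMem hvT] at hYe
    omega

end TwoRootsMain

section CutVertices

variable {V : Type} [DecidableEq V] {G : SimpleGraph V} {x b c y b' c' : V}

theorem PendantTriangle.conn_sdiff (h : PendantTriangle G x b c) {S : Finset V} (hS : Conn G S)
    (hn : (S \ {b, c}).Nonempty) : Conn G (S \ {b, c}) := by
  obtain ⟨hxb, hxc, -, hb, hc⟩ := h
  have ht : ∀ u ∈ ({b, c} : Finset V), ∀ w ∉ ({b, c} : Finset V), G.Adj u w → w = x := by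
    intro u hu w hw huw
    simp only [Finset.mem_insert, Finset.mem_singleton, not_or] at hu hw
    rcases hu with rfl | rfl
    · exact (hb w huw).resolve_right hw.2
    · exact (hc w huw).resolve_right hw.1
  by_cases hx : x ∈ S
  · have hs := hS.sdiff (conn_singleton x) (by simpa using hx) (U := S ∩ {b, c}) (fun w hw => by
      simp only [Finset.mem_inter, Finset.mem_sdiff, Finset.mem_insert, Finset.mem_singleton] at *
      refine ⟨hw.1, ?_⟩
      rintro rfl
      rcases hw.2 with rfl | rfl
      · exact G.irrefl hxb
      · exact G.irrefl hxc) (by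
      rintro ⟨u, hu, w, hw, huw⟩
      have hw' := ht u (Finset.mem_inter.1 hu).2 w (fun h => by
        simp only [Finset.mem_sdiff, Finset.mem_inter] at hw
        tauto) huw
      subst hw'
      simp at hw)
    rwa [Finset.sdiff_inter_self_left] at hs
  · rcases hS.subset_or (P := S \ {b, c}) (Q := {b, c})
      (by rw [Finset.sdiff_union_self_eq_union]; exact Finset.subset_union_left) (by
      rintro ⟨u, hu, w, hw, huw⟩
      rw [Finset.mem_sdiff] at hu
      exact hx (ht w hw u hu.2 huw.symm ▸ hu.1)) with h | h
    · rwa [Finset.Subset.antisymm Finset.sdiff_subset h]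
    · rw [Finset.sdiff_nonempty] at hn
      exact absurd h hn

theorem PendantTriangle.edgeCount_le (h : PendantTriangle G x b c) {S : Finset V} (hb : b ∈ S)
    (hc : c ∈ S) : edgeCount G S ≤ edgeCount G (S \ {b, c}) + 3 ∧
      S.card = (S \ {b, c}).card + 2 := by
  classical
  have hbc : b ≠ c := h.2.2.1.ne
  have hsub : {b, c} ⊆ S := by
    rw [Finset.insert_subset_iff, Finset.singleton_subset_iff]
    exact ⟨hb, hc⟩
  have e1 : crossCount G {b} {c} = 1 := by
    simp only [crossCount, Finset.sum_singleton, if_pos h.2.2.1]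
  have key : ∀ u ∈ ({b, c} : Finset V), crossCount G {u} (S \ {b, c}) ≤ 1 := by
    intro u hu
    rw [crossCount_singleton_left]
    refine (Finset.card_le_card (t := {x}) fun w hw => ?_).trans (by simp)
    simp only [Finset.mem_filter, Finset.mem_sdiff, Finset.mem_insert, Finset.mem_singleton,
      not_or] at hu hw ⊢
    rcases hu with rfl | rfl
    · exact (h.2.2.2.1 w hw.2).resolve_right hw.1.2.2
    · exact (h.2.2.2.2 w hw.2).resolve_right hw.1.2.1
  have hk1 := key b (by simp)
  have hk2 := key c (by simp)
  have hE := edgeCount_sdiff_add (G := G) hsub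
  rw [edgeCount_insert (by simpa using hbc), edgeCount_singleton, e1] at hE
  have hX := crossCount_union_left (G := G) (A := {b}) (B := {c}) (C := S \ {b, c})
    (by simpa using hbc)
  rw [← Finset.insert_eq] at hX
  have := Finset.card_sdiff_add_card_eq_card hsub
  rw [Finset.card_pair hbc] at this
  omega

omit [DecidableEq V] in
theorem PendantTriangle.nodup (h : PendantTriangle G x b c) (h' : PendantTriangle G y b' c')
    (hxy : x ≠ y) (hyb : y ≠ b) (hyc : y ≠ c) :
    [b, c, b', c'].Nodup ∧ x ≠ b' ∧ x ≠ c' := by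
  obtain ⟨hxb, hxc, hbc, hb, hc⟩ := h
  obtain ⟨hyb', hyc', hbc', hb', hc'⟩ := h'
  have e1 := hbc.ne
  have e2 := hbc'.ne
  have e3 : b ≠ b' := fun h => by have := hb y (h ▸ hyb'.symm); grind
  have e4 : b ≠ c' := fun h => by have := hb y (h ▸ hyc'.symm); grind
  have e5 : c ≠ b' := fun h => by have := hc y (h ▸ hyb'.symm); grind
  have e6 : c ≠ c' := fun h => by have := hc y (h ▸ hyc'.symm); grind
  refine ⟨by simp [*], fun h => ?_, fun h => ?_⟩
  · have := hb' b (h ▸ hxb)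
    grind
  · have := hc' b (h ▸ hxb)
    grind

variable [Fintype V]

/-- An obstruction outside the list has at most two pendent triangles with distinct roots. -/
theorem ObsApexPseudoforest.not_three_pendantTriangles (h1 : ObsApexPseudoforest G)
    (h2 : ¬ InO G) {z b'' c'' : V} (hx : PendantTriangle G x b c) (hy : PendantTriangle G y b' c')
    (hz : PendantTriangle G z b'' c'') (hxy : x ≠ y) (hxz : x ≠ z) (hyz : y ≠ z)
    (hyx' : y ≠ b ∧ y ≠ c) (hzx' : z ≠ b ∧ z ≠ c) (hzy' : z ≠ b' ∧ z ≠ c') : False := by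
  obtain ⟨hn, hxb', hxc'⟩ := hx.nodup hy hxy hyx'.1 hyx'.2
  obtain ⟨hnx, hxb'', hxc''⟩ := hx.nodup hz hxz hzx'.1 hzx'.2
  obtain ⟨hny, hyb'', hyc''⟩ := hy.nodup hz hyz hzy'.1 hzy'.2
  set H : Finset V := ((Finset.univ \ {b, c}) \ {b', c'}) \ {b'', c''} with hHdef
  have hmem : ∀ (K : Finset V) v, v ∈ ((K \ {b, c}) \ {b', c'}) \ {b'', c''} ↔
      v ∈ K ∧ v ≠ b ∧ v ≠ c ∧ v ≠ b' ∧ v ≠ c' ∧ v ≠ b'' ∧ v ≠ c'' := by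
    intro K v
    simp only [Finset.mem_sdiff, Finset.mem_insert, Finset.mem_singleton]
    tauto
  have hH : ∀ v, v ∈ H ↔ v ≠ b ∧ v ≠ c ∧ v ≠ b' ∧ v ≠ c' ∧ v ≠ b'' ∧ v ≠ c'' := by
    intro v
    rw [hHdef, hmem]
    simp only [Finset.mem_univ, true_and]
  have hconn : ∀ K : Finset V, Conn G K → (∃ w ∈ K, w ∈ H) →
      Conn G (((K \ {b, c}) \ {b', c'}) \ {b'', c''}) := by
    rintro K hK ⟨w, hwK, hwH⟩
    have hw := (hmem K w).2 ⟨hwK, (hH w).1 hwH⟩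
    exact hz.conn_sdiff (hy.conn_sdiff (hx.conn_sdiff hK ⟨w, (Finset.mem_sdiff.1
      (Finset.mem_sdiff.1 hw).1).1⟩) ⟨w, (Finset.mem_sdiff.1 hw).1⟩) ⟨w, hw⟩
  have hxH : x ∈ H := (hH x).2 ⟨hx.1.ne, hx.2.1.ne, hxb', hxc', hxb'', hxc''⟩
  have hyH : y ∈ H := (hH y).2 ⟨hyx'.1, hyx'.2, hy.1.ne, hy.2.1.ne, hyb'', hyc''⟩
  have hzH : z ∈ H := (hH z).2 ⟨hzx'.1, hzx'.2, hzy'.1, hzy'.2, hz.1.ne, hz.2.1.ne⟩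
  have hHc : Conn G H := hconn _ (h1.conn_univ h2 x) ⟨x, Finset.mem_univ _, hxH⟩
  have hK : ∀ v ∈ H, ∃ K ⊆ H, v ∉ K ∧ Conn G K ∧
      (x ≠ v → x ∈ K) ∧ (y ≠ v → y ∈ K) ∧ (z ≠ v → z ∈ K) := by
    intro v hv
    have hv' := (hH v).1 hv
    obtain ⟨K, hK, hvK, hKm⟩ : ∃ K, Conn G K ∧ v ∉ K ∧
        ∀ w p q, w ≠ v → PendantTriangle G w p q → v ≠ p → v ≠ q → w ∈ K := by
      by_cases hvc : Conn G (Finset.univ \ {v})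
      · exact ⟨_, hvc, by simp, fun w _ _ hwv _ _ _ => by simpa using hwv⟩
      · obtain ⟨p, q, hvt, hvc, -⟩ := h1.exists_pendantTriangle h2 hvc
        refine ⟨_, hvc, by simp, fun w p' q' hwv hw hvp hvq => ?_⟩
        have := hw.nodup hvt hwv hvp hvq
        simp [hwv, this.2]
    have hxK := fun h => hKm x b c h hx hv'.1 hv'.2.1
    have hyK := fun h => hKm y b' c' h hy hv'.2.2.1 hv'.2.2.2.1
    have hzK := fun h => hKm z b'' c'' h hz hv'.2.2.2.2.1 hv'.2.2.2.2.2
    refine ⟨((K \ {b, c}) \ {b', c'}) \ {b'', c''},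
      fun u hu => (hH u).2 ((hmem K u).1 hu).2, fun h => hvK ((hmem K v).1 h).1,
      hconn K hK ?_, fun h => (hmem K x).2 ⟨hxK h, (hH x).1 hxH⟩,
      fun h => (hmem K y).2 ⟨hyK h, (hH y).1 hyH⟩, fun h => (hmem K z).2 ⟨hzK h, (hH z).1 hzH⟩⟩
    by_cases hvx : x = v
    · exact ⟨y, hyK (hvx ▸ hxy.symm), hyH⟩
    · exact ⟨x, hxK hvx, hxH⟩
  obtain ⟨X, Y, Z, hX, hY, hZ, hd, t1, t2, t3⟩ :=
    hHc.exists_touching_triple hxH hyH hzH hxy hxz hyz hK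
  have hb : ∀ v ∈ H, v ≠ b ∧ v ≠ c ∧ v ≠ b' ∧ v ≠ c' ∧ v ≠ b'' ∧ v ≠ c'' := fun v => (hH v).1
  exact TwoPendant.no_three_pendant h1 h2 (H := H)
    ⟨hx, hy, hn, fun h => (hb _ h).1 rfl, fun h => (hb _ h).2.1 rfl,
      fun h => (hb _ h).2.2.1 rfl, fun h => (hb _ h).2.2.2.1 rfl⟩
    ⟨hx, hz, hnx, fun h => (hb _ h).1 rfl, fun h => (hb _ h).2.1 rfl,
      fun h => (hb _ h).2.2.2.2.1 rfl, fun h => (hb _ h).2.2.2.2.2 rfl⟩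
    hny hX hY hZ hd t1 t2 t3

theorem ObsApexPseudoforest.conn_sdiff_of_pendantTriangle (h1 : ObsApexPseudoforest G)
    (h2 : ¬ InO G) (hx : PendantTriangle G x b c) (hxc : Conn G (Finset.univ \ {x, b, c}))
    (hxe : (Finset.univ \ {x, b, c}).card < edgeCount G (Finset.univ \ {x, b, c}))
    (hxy : x ≠ y) (hyb : y ≠ b) (hyc : y ≠ c) : Conn G (Finset.univ \ {y}) := by
  by_contra hy'
  obtain ⟨b', c', hy, hyc', hye⟩ := h1.exists_pendantTriangle h2 hy'
  obtain ⟨hn, hxb', hxc'⟩ := hx.nodup hy hxy hyb hyc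
  have hz : ∀ z, z ≠ x → z ≠ y → z ≠ b → z ≠ c → z ≠ b' → z ≠ c' →
      Conn G (Finset.univ \ {z}) := by
    intro z hzx hzy hzb hzc hzb' hzc'
    by_contra hz'
    obtain ⟨b'', c'', hz, -⟩ := h1.exists_pendantTriangle h2 hz'
    exact h1.not_three_pendantTriangles h2 hx hy hz hxy hzx.symm hzy.symm ⟨hyb, hyc⟩ ⟨hzb, hzc⟩
      ⟨hzb', hzc'⟩
  set H : Finset V := (Finset.univ \ {b, c}) \ {b', c'} with hHdef
  have hH : ∀ v, v ∈ H ↔ v ≠ b ∧ v ≠ c ∧ v ≠ b' ∧ v ≠ c' := by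
    intro v
    simp only [hHdef, Finset.mem_sdiff, Finset.mem_univ, Finset.mem_insert, Finset.mem_singleton]
    tauto
  have hxH : x ∈ H := (hH x).2 ⟨hx.1.ne, hx.2.1.ne, hxb', hxc'⟩
  have hyH : y ∈ H := (hH y).2 ⟨hyb, hyc, hy.1.ne, hy.2.1.ne⟩
  have hxS : (Finset.univ \ {x, b, c}) \ {b', c'} = H \ {x} := by
    ext w
    simp only [Finset.mem_sdiff, hH, Finset.mem_univ, Finset.mem_insert, Finset.mem_singleton]
    tauto
  have hyS : (Finset.univ \ {y, b', c'}) \ {b, c} = H \ {y} := by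
    ext w
    simp only [Finset.mem_sdiff, hH, Finset.mem_univ, Finset.mem_insert, Finset.mem_singleton]
    tauto
  simp only [List.nodup_cons, List.mem_cons, List.not_mem_nil, or_false, not_or] at hn
  have hex := hy.edgeCount_le (S := Finset.univ \ {x, b, c})
    (by simp [hxb'.symm, Ne.symm hn.1.2.1, Ne.symm hn.2.1.1])
    (by simp [hxc'.symm, Ne.symm hn.1.2.2, Ne.symm hn.2.1.2])
  have hey := hx.edgeCount_le (S := Finset.univ \ {y, b', c'})
    (by simp [hyb.symm, hn.1.2.1, hn.1.2.2]) (by simp [hyc.symm, hn.2.1.1, hn.2.1.2])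
  rw [hxS] at hex
  rw [hyS] at hey
  have hxyH : ((H \ {x}).Nonempty) := ⟨y, by simp [hyH, hxy.symm]⟩
  have hyxH : ((H \ {y}).Nonempty) := ⟨x, by simp [hxH, hxy]⟩
  refine TwoPendant.false_of_conn_sdiff h1 h2 (H := H) ⟨hx, hy, by simp [hn], by simp [hH]⟩
    hxH hyH hxy (fun w hw => ?_) (by omega) (by omega)
  by_cases hwx : w = x
  · subst hwx
    rw [← hxS] at hxyH ⊢
    exact hy.conn_sdiff hxc hxyH
  by_cases hwy : w = y
  · subst hwy
    rw [← hyS] at hyxH ⊢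
    exact hx.conn_sdiff hyc' hyxH
  have he : H \ {w} = ((Finset.univ \ {w}) \ {b, c}) \ {b', c'} := by
    ext u
    simp only [Finset.mem_sdiff, hH, Finset.mem_univ, Finset.mem_insert, Finset.mem_singleton]
    tauto
  have hw' := (hH w).1 hw
  have hxw : x ∈ H \ {w} := by simp [hxH, Ne.symm hwx]
  rw [he] at hxw ⊢
  exact hy.conn_sdiff (hx.conn_sdiff (hz w hwx hwy hw'.1 hw'.2.1 hw'.2.2.1 hw'.2.2.2)
    ⟨x, (Finset.mem_sdiff.1 hxw).1⟩) ⟨x, hxw⟩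

/-- The graph without the tips of a pendent triangle has no cut-vertex. -/
theorem ObsApexPseudoforest.conn_sdiff_singleton (h1 : ObsApexPseudoforest G) (h2 : ¬ InO G)
    (hx : PendantTriangle G x b c) (hxc : Conn G (Finset.univ \ {x, b, c}))
    (hxe : (Finset.univ \ {x, b, c}).card < edgeCount G (Finset.univ \ {x, b, c})) {v : V}
    (hv : v ∈ Finset.univ \ {b, c}) : Conn G ((Finset.univ \ {b, c}) \ {v}) := by
  have he : (Finset.univ \ {b, c}) \ {v} = (Finset.univ \ {v}) \ {b, c} := by
    ext u
    simp only [Finset.mem_sdiff, Finset.mem_univ, Finset.mem_insert, Finset.mem_singleton]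
    tauto
  by_cases hvx : v = x
  · subst hvx
    have : (Finset.univ \ {b, c}) \ {v} = Finset.univ \ {v, b, c} := by
      ext u
      simp only [Finset.mem_sdiff, Finset.mem_univ, Finset.mem_insert, Finset.mem_singleton]
      tauto
    rwa [this]
  · simp only [Finset.mem_sdiff, Finset.mem_univ, true_and, Finset.mem_insert,
      Finset.mem_singleton, not_or] at hv
    rw [he]
    exact hx.conn_sdiff (h1.conn_sdiff_of_pendantTriangle h2 hx hxc hxe (Ne.symm hvx) hv.1 hv.2)
      ⟨x, by simp [Ne.symm hvx, hx.1.ne, hx.2.1.ne]⟩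

end CutVertices

section TwoConnected

variable {V : Type} [DecidableEq V] {G : SimpleGraph V}

/-- In a set without cut-vertices, any two nonadjacent vertices are joined through two disjoint
connected sets. -/
theorem exists_disjoint_conn_between {W : Finset V} (hW : ∀ v ∈ W, Conn G (W \ {v})) {u v : V}
    (hWc : Conn G W) (hu : u ∈ W) (hv : v ∈ W) (huv : u ≠ v) (hadj : ¬ G.Adj u v) :
    ∃ A B, Disjoint A B ∧ A ⊆ W \ {u, v} ∧ B ⊆ W \ {u, v} ∧ Conn G A ∧ Conn G B ∧
      Touch G {u} A ∧ Touch G {v} A ∧ Touch G {u} B ∧ Touch G {v} B := by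
  classical
  let good : V → Prop := fun w => G.Adj u w ∨ ∃ A B, Disjoint A B ∧ A ⊆ W \ {u, w} ∧
    B ⊆ W \ {u, w} ∧ Conn G A ∧ Conn G B ∧ Touch G {u} A ∧ Touch G {w} A ∧ Touch G {u} B ∧
    Touch G {w} B
  have hstep : ∀ s w K B, G.Adj s w → s ∈ W → u ≠ s → u ≠ w → Conn G K → u ∈ K → w ∈ K →
      K ⊆ (W \ {s}) \ B → ¬ G.Adj u w → B ⊆ W \ {u, s} → Conn G (insert s B) →
      Touch G {u} (insert s B) → good w := by
    intro s w K B hsw hs hus huw hK huK hwK hKB hnw hB hBc hBu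
    obtain ⟨A, hAK, huA, hwA, hA, tuA, twA⟩ := hK.exists_between huK hwK huw hnw
    refine Or.inr ⟨A, insert s B, ?_, ?_, ?_, hA, hBc, tuA, twA, hBu, ⟨w, by simp, s, by simp,
      hsw.symm⟩⟩
    · rw [Finset.disjoint_left]
      intro a ha
      have := hKB (hAK ha)
      simp only [Finset.mem_sdiff, Finset.mem_singleton] at this
      simp [this]
    · intro a ha
      have := hKB (hAK ha)
      simp only [Finset.mem_sdiff, Finset.mem_singleton, Finset.mem_insert] at this ⊢
      refine ⟨this.1.1, ?_⟩
      rintro (rfl | rfl) <;> contradiction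
    · intro a ha
      have hwB := hKB hwK
      simp only [Finset.mem_sdiff, Finset.mem_singleton, Finset.mem_insert] at hwB ha ⊢
      rcases ha with rfl | ha
      · exact ⟨hs, by rintro (h | h); exacts [hus h.symm, hsw.ne h]⟩
      · have := hB ha
        simp only [Finset.mem_sdiff, Finset.mem_singleton, Finset.mem_insert] at this
        refine ⟨this.1, ?_⟩
        rintro (rfl | rfl)
        · exact this.2 (Or.inl rfl)
        · exact hwB.2 ha
  suffices hg : good v from hg.resolve_left hadj
  by_contra hgv
  have hP : ((W \ {u}).filter good).Nonempty := by
    obtain ⟨a, ha, w, hw, huw⟩ := hWc.touch (P := {u}) (by simpa using hu) (by simp)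
      (fun h => huv.symm (by rw [← h] at hv; simpa using hv))
    rw [Finset.mem_singleton] at ha
    subst ha
    exact ⟨w, Finset.mem_filter.2 ⟨hw, Or.inl huw⟩⟩
  obtain ⟨s, hs, w, hw, hsw⟩ := (hW u hu).touch (Finset.filter_subset good _) hP (fun h => by
    have : v ∈ (W \ {u}).filter good := by rw [h]; simp [hv, huv.symm]
    exact hgv (Finset.mem_filter.1 this).2)
  simp only [Finset.mem_filter, Finset.mem_sdiff, Finset.mem_singleton, not_and] at hs hw
  obtain ⟨⟨hsW, hsu⟩, hsg⟩ := hs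
  obtain ⟨⟨hwW, hwu⟩, hwg⟩ := hw
  have hwg := hwg ⟨hwW, hwu⟩
  have huw : ¬ G.Adj u w := fun h => hwg (Or.inl h)
  have huWs : u ∈ W \ {s} := by simp [hu, Ne.symm hsu]
  have hwWs : w ∈ W \ {s} := by simp [hwW, hsw.ne']
  rcases hsg with hus | ⟨A, B, hd, hA, hB, hAc, hBc, tuA, tsA, tuB, tsB⟩
  · exact hwg (hstep s w (W \ {s}) ∅ hsw hsW (Ne.symm hsu) (Ne.symm hwu) (hW s hsW) huWs hwWs
      (by simp) huw (by simp) (by simpa using conn_singleton s) ⟨u, by simp, s, by simp, hus⟩)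
  · have hsub : ∀ {C D : Finset V}, Disjoint C D → C ⊆ W \ {u, s} → D ⊆ W \ {u, s} →
        insert u C ⊆ (W \ {s}) \ D := by
      intro C D hCD hC hD a ha
      rw [Finset.mem_insert] at ha
      rcases ha with rfl | ha
      · exact Finset.mem_sdiff.2 ⟨huWs, fun h => by simpa using hD h⟩
      · have := hC ha
        simp only [Finset.mem_sdiff, Finset.mem_insert, Finset.mem_singleton, not_or] at this ⊢
        exact ⟨⟨this.1, this.2.2⟩, Finset.disjoint_left.1 hCD ha⟩
    obtain ⟨K, hK, hAK⟩ := exists_isComp (hAc.insert_vertex tuA) (hsub hd hA hB)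
    obtain ⟨L, hL, hBL⟩ := exists_isComp (hBc.insert_vertex tuB) (hsub hd.symm hB hA)
    rw [Finset.insert_subset_iff] at hAK hBL
    have hwK : w ∉ K := fun h => hwg (hstep s w K B hsw hsW (Ne.symm hsu) (Ne.symm hwu) hK.2.1
      hAK.1 h hK.1 huw hB (hBc.insert_vertex tsB) (tuB.mono subset_rfl (Finset.subset_insert _ _)))
    have hwL : w ∉ L := fun h => hwg (hstep s w L A hsw hsW (Ne.symm hsu) (Ne.symm hwu) hL.2.1
      hBL.1 h hL.1 huw hA (hAc.insert_vertex tsA) (tuA.mono subset_rfl (Finset.subset_insert _ _)))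
    obtain ⟨a, ha, d, hd', had⟩ := (hW s hsW).touch (P := K ∪ L)
      (Finset.union_subset (hK.1.trans Finset.sdiff_subset) (hL.1.trans Finset.sdiff_subset))
      ⟨u, Finset.mem_union_left _ hAK.1⟩ (fun h => by
        rw [← h, Finset.mem_union] at hwWs
        tauto)
    rw [Finset.mem_sdiff, Finset.mem_union, not_or] at hd'
    rcases Finset.mem_union.1 ha with ha | ha
    · by_cases hdB : d ∈ B
      · exact hd'.2.2 (hBL.2 hdB)
      · exact hK.2.2 ⟨a, ha, d, by simp [hdB, hd'.2.1, Finset.mem_sdiff.1 hd'.1], had⟩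
    · by_cases hdA : d ∈ A
      · exact hd'.2.1 (hAK.2 hdA)
      · exact hL.2.2 ⟨a, ha, d, by simp [hdA, hd'.2.2, Finset.mem_sdiff.1 hd'.1], had⟩

theorem Conn.exists_isPath {B : Finset V} (hB : Conn G B) {u v : V} (huv : u ≠ v) (hu : u ∉ B)
    (hv : v ∉ B) (hut : Touch G {u} B) (hvt : Touch G {v} B) :
    ∃ p : G.Walk u v, p.IsPath ∧ (∀ w ∈ p.support, w = u ∨ w = v ∨ w ∈ B) ∧
      ∃ w ∈ B, w ∈ p.support := by
  obtain ⟨u', hu', a, ha, hua⟩ := hut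
  obtain ⟨v', hv', d, hd, hvd⟩ := hvt
  rw [Finset.mem_singleton] at hu' hv'
  subst hu' hv'
  obtain ⟨q, hq⟩ := hB.induce_connected.exists_isPath ⟨a, ha⟩ ⟨d, hd⟩
  have hmap : ∀ {s t : (B : Set V)} (q : (G.induce (B : Set V)).Walk s t),
      ∀ w ∈ (q.map (Embedding.induce (G := G) (B : Set V)).toHom).support, w ∈ B := by
    intro s t q w hw
    rw [Walk.support_map, List.mem_map] at hw
    obtain ⟨z, -, rfl⟩ := hw
    exact z.2
  obtain ⟨r, hrp, hrs⟩ : ∃ r : G.Walk a d, r.IsPath ∧ ∀ w ∈ r.support, w ∈ B :=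
    ⟨_, hq.map (Embedding.induce (G := G) (B : Set V)).injective, hmap q⟩
  refine ⟨Walk.cons hua (r.concat hvd.symm), ?_, ?_, a, ha, ?_⟩
  · rw [Walk.cons_isPath_iff, Walk.support_concat]
    refine ⟨hrp.concat (fun h => hv (hrs _ h)) _, ?_⟩
    simp only [List.mem_append, List.mem_singleton, not_or]
    exact ⟨fun h => hu (hrs _ h), huv⟩
  · intro w hw
    simp only [Walk.support_cons, Walk.support_concat,
      List.mem_cons, List.mem_append, List.not_mem_nil, or_false] at hw
    rcases hw with h | h | h
    · exact Or.inl h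
    · exact Or.inr (Or.inr (hrs _ h))
    · exact Or.inr (Or.inl h)
  · simp [Walk.support_concat]

/-- A connected set with at least three vertices and no cut-vertex is biconnected. -/
theorem Conn.kConnected_two {W : Finset V} (hWc : Conn G W) (hcard : 2 < W.card)
    (hW : ∀ v ∈ W, Conn G (W \ {v})) : KConnected 2 (G.induce (W : Set V)) := by
  rintro ⟨u, hu⟩ ⟨v, hv⟩ huv
  rw [Finset.mem_coe] at hu hv
  have huv : u ≠ v := fun h => huv (Subtype.ext h)
  suffices h : ∃ p q : G.Walk u v, p.IsPath ∧ q.IsPath ∧ p ≠ q ∧ (∀ w ∈ p.support, w ∈ W) ∧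
      (∀ w ∈ q.support, w ∈ W) ∧ ∀ w ∈ p.support, w ∈ q.support → w = u ∨ w = v by
    obtain ⟨p, q, hp, hq, hpq, hpW, hqW, hd⟩ := h
    have hind : ∀ {r : G.Walk u v} (hr : ∀ w ∈ r.support, w ∈ (W : Set V)), r.IsPath →
        (r.induce _ hr).IsPath := by
      intro r hr hrp
      rw [← Walk.map_induce r hr] at hrp
      exact hrp.of_map
    have hne : p.induce (W : Set V) hpW ≠ q.induce (W : Set V) hqW := fun h => hpq (by
      rw [← Walk.map_induce p hpW, h, Walk.map_induce])
    have hds : ∀ w, w ∈ (p.induce (W : Set V) hpW).support →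
        w ∈ (q.induce (W : Set V) hqW).support → w = ⟨u, hu⟩ ∨ w = ⟨v, hv⟩ := by
      rintro ⟨w, hw⟩ h1 h2
      simp only [Walk.support_induce, List.mem_attachWith] at h1 h2
      simpa only [Subtype.mk.injEq] using hd w h1 h2
    refine ⟨![p.induce _ hpW, q.induce _ hqW], ?_, ?_, ?_⟩
    · intro i j hij
      fin_cases i <;> fin_cases j <;> first | rfl | exact absurd hij hne | exact absurd hij.symm hne
    · intro i
      fin_cases i
      · exact hind hpW hp
      · exact hind hqW hq
    · intro i j hij w h1 h2
      fin_cases i <;> fin_cases j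
      · exact absurd rfl hij
      · exact hds w h1 h2
      · exact hds w h2 h1
      · exact absurd rfl hij
  by_cases hadj : G.Adj u v
  · obtain ⟨s, hs⟩ : (W \ {u, v}).Nonempty := by
      rw [← Finset.card_pos]
      have := Finset.le_card_sdiff {u, v} W
      have := Finset.card_le_two (a := u) (b := v)
      omega
    obtain ⟨B, hB, -⟩ := exists_isComp (G := G) (S := W \ {u, v}) (conn_singleton s)
      (by simpa using hs)
    have huB : u ∉ B := fun h => by simpa using hB.1 h
    have hvB : v ∉ B := fun h => by simpa using hB.1 h
    have htouch : ∀ {a d : V}, a ∈ W → d ∈ W → a ≠ d → ({a, d} : Finset V) = {u, v} →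
        Touch G {a} B := by
      intro a d ha hd had he
      rw [← he] at hB
      have haB : a ∉ B := fun h => by simpa using hB.1 h
      obtain ⟨t, ht, w, hw, htw⟩ := (hW d hd).touch (P := B) (fun w hw => by
        have := hB.1 hw
        simp only [Finset.mem_sdiff, Finset.mem_insert, Finset.mem_singleton, not_or] at this ⊢
        tauto) hB.2.1.1 (fun h => haB (by rw [h]; simp [ha, had]))
      by_cases hwa : w = a
      · exact ⟨w, by simpa using hwa, t, ht, htw.symm⟩
      · simp only [Finset.mem_sdiff, Finset.mem_singleton] at hw
        exact absurd ⟨t, ht, w, by simp [hw, hwa], htw⟩ hB.2.2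
    obtain ⟨q, hq, hqs, w, hwB, hwq⟩ := hB.2.1.exists_isPath huv huB hvB
      (htouch hu hv huv rfl) (htouch hv hu huv.symm (Finset.pair_comm _ _))
    have hps : hadj.toWalk.support = [u, v] := rfl
    refine ⟨hadj.toWalk, q, ?_, hq, ?_, ?_, ?_, ?_⟩
    · rw [Walk.isPath_def, hps]
      simpa using huv
    · rintro rfl
      rw [hps] at hwq
      simp only [List.mem_cons, List.not_mem_nil, or_false] at hwq
      rcases hwq with rfl | rfl <;> contradiction
    · simp [hps, hu, hv]
    · intro z hz
      rcases hqs z hz with rfl | rfl | h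
      exacts [hu, hv, (Finset.mem_sdiff.1 (hB.1 h)).1]
    · intro z hz _
      simpa [hps] using hz
  · obtain ⟨A, B, hd, hA, hB, hAc, hBc, tuA, tvA, tuB, tvB⟩ :=
      exists_disjoint_conn_between hW hWc hu hv huv hadj
    obtain ⟨p, hp, hps, w, hwA, hwp⟩ := hAc.exists_isPath huv (fun h => by simpa using hA h)
      (fun h => by simpa using hA h) tuA tvA
    obtain ⟨q, hq, hqs, -⟩ := hBc.exists_isPath huv (fun h => by simpa using hB h)
      (fun h => by simpa using hB h) tuB tvB
    have hcap : ∀ z ∈ p.support, z ∈ q.support → z = u ∨ z = v := by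
      intro z hzp hzq
      rcases hps z hzp with h | h | h
      · exact Or.inl h
      · exact Or.inr h
      · rcases hqs z hzq with h' | h' | h'
        · exact Or.inl h'
        · exact Or.inr h'
        · exact absurd h' (Finset.disjoint_left.1 hd h)
    refine ⟨p, q, hp, hq, ?_, ?_, ?_, hcap⟩
    · rintro rfl
      have := hA hwA
      rcases hcap w hwp hwp with rfl | rfl <;> simp at this
    · intro z hz
      rcases hps z hz with rfl | rfl | h
      exacts [hu, hv, (Finset.mem_sdiff.1 (hA h)).1]
    · intro z hz
      rcases hqs z hz with rfl | rfl | h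
      exacts [hu, hv, (Finset.mem_sdiff.1 (hB h)).1]

end TwoConnected

section Components

variable {V : Type} [DecidableEq V] {G : SimpleGraph V} {x : V}

theorem Conn.exists_connectedComponent {Z : Finset V} (hZ : Conn G Z) (hx : x ∉ Z)
    (hcl : ∀ u ∈ Z, ∀ w, w ≠ x → G.Adj u w → w ∈ Z) :
    ∃ C : (G.induce ({x}ᶜ : Set V)).ConnectedComponent, Subtype.val '' C.supp = (Z : Set V) := by
  obtain ⟨p, hp⟩ := hZ.1
  have hle : (Z : Set V) ≤ ({x}ᶜ : Set V) := fun z hz h => hx (h ▸ hz)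
  refine ⟨(G.induce ({x}ᶜ : Set V)).connectedComponentMk ⟨p, hle hp⟩, ?_⟩
  ext z
  simp only [Set.mem_image, ConnectedComponent.mem_supp_iff, ConnectedComponent.eq, Finset.mem_coe]
  constructor
  · rintro ⟨z, ⟨hr⟩, rfl⟩
    by_contra hz
    obtain ⟨d, -, hd1, hd2⟩ := hr.reverse.exists_boundary_dart {w | w.1 ∈ Z} hp hz
    exact hd2 (hcl _ hd1 _ d.snd.2 (by simpa using d.adj))
  · intro hz
    exact ⟨⟨z, hle hz⟩, (hZ.induce_connected.preconnected ⟨z, hz⟩ ⟨p, hp⟩).map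
      (induceHomOfLE G hle).toHom, rfl⟩

omit [DecidableEq V] in
theorem IsNClique.nonempty_iso {S : Finset V} {n : ℕ} (h : G.IsNClique n S) :
    Nonempty (G.induce (S : Set V) ≃g completeGraph (Fin n)) := by
  have hG : G.induce (S : Set V) = completeGraph _ := by
    ext ⟨u, hu⟩ ⟨v, hv⟩
    simpa using ⟨Adj.ne, fun huv => h.1 hu hv huv⟩
  rw [hG]
  exact ⟨Iso.completeGraph (S.equivFinOfCardEq h.2)⟩

variable [Fintype V]

theorem CutVertex.not_conn (h : CutVertex G x) : ¬ Conn G (Finset.univ \ {x}) := by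
  intro hc
  have hconn := hc.induce_connected
  rw [show ((Finset.univ \ {x} : Finset V) : Set V) = {x}ᶜ by ext; simp] at hconn
  have := hconn.preconnected.subsingleton_connectedComponent
  have h1 := Finite.card_le_one_iff_subsingleton.2 this
  have : Nonempty G.ConnectedComponent := ⟨G.connectedComponentMk x⟩
  have h2 : 0 < Nat.card G.ConnectedComponent := Nat.card_pos
  unfold CutVertex at h
  omega

end Components

/-- If an obstruction for apex-pseudoforests not isomorphic to a member of `O` has a
cut-vertex `x`, then `G - x` has exactly two connected components, and of the two
augmented components one is biconnected and the other is a triangle. -/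
theorem obstruction_cutVertex_structure {V : Type} [Finite V] (G : SimpleGraph V)
    (h1 : ObsApexPseudoforest G) (h2 : ¬ InO G) (x : V) (hx : CutVertex G x) :
    Nat.card (G.induce ({x}ᶜ : Set V)).ConnectedComponent = 2 ∧
    ∃ C₁ C₂ : (G.induce ({x}ᶜ : Set V)).ConnectedComponent, C₁ ≠ C₂ ∧
      KConnected 2 (G.induce (Subtype.val '' C₁.supp ∪ {x})) ∧
      Nonempty ((G.induce (Subtype.val '' C₂.supp ∪ {x})) ≃g completeGraph (Fin 3)) := by
  classical
  have := Fintype.ofFinite V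
  obtain ⟨b, c, ht, hV, he⟩ := h1.exists_pendantTriangle h2 hx.not_conn
  have hmV : ∀ v, v ∈ Finset.univ \ {x, b, c} ↔ v ≠ x ∧ v ≠ b ∧ v ≠ c := by simp
  have hxb := ht.1.ne
  have hxc := ht.2.1.ne
  obtain ⟨C₁, hC₁⟩ := hV.exists_connectedComponent (x := x) (by simp) (fun u hu w hwx huw => by
    rw [hmV] at hu ⊢
    refine ⟨hwx, ?_, ?_⟩
    · rintro rfl
      have := ht.2.2.2.1 u huw.symm
      tauto
    · rintro rfl
      have := ht.2.2.2.2 u huw.symm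
      tauto)
  have hbc : Conn G {b, c} := (conn_singleton c).insert_vertex ⟨b, by simp, c, by simp, ht.2.2.1⟩
  obtain ⟨C₂, hC₂⟩ := hbc.exists_connectedComponent (x := x) (by simp [hxb, hxc])
    (fun u hu w hwx huw => by
      rw [Finset.mem_insert, Finset.mem_singleton] at hu ⊢
      rcases hu with rfl | rfl
      · exact Or.inr ((ht.2.2.2.1 w huw).resolve_left hwx)
      · exact Or.inl ((ht.2.2.2.2 w huw).resolve_left hwx))
  have hne : C₁ ≠ C₂ := by
    rintro rfl
    have hb : b ∈ ((Finset.univ \ {x, b, c} : Finset V) : Set V) := by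
      rw [← hC₁, hC₂]
      simp
    simp at hb
  have hcover : ({C₁, C₂} : Set _) = Set.univ := by
    refine Set.eq_univ_of_forall fun C => ?_
    induction C using ConnectedComponent.ind with | h v => ?_
    have hmem : ∀ D : (G.induce ({x}ᶜ : Set V)).ConnectedComponent,
        v.1 ∈ Subtype.val '' D.supp → (G.induce ({x}ᶜ : Set V)).connectedComponentMk v = D := by
      rintro D ⟨w, hw, hwv⟩
      rwa [← Subtype.ext hwv]
    by_cases hv : v.1 ∈ ({b, c} : Finset V)
    · exact Or.inr (hmem C₂ (hC₂ ▸ hv))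
    · rw [Finset.mem_insert, Finset.mem_singleton, not_or] at hv
      exact Or.inl (hmem C₁ (by rw [hC₁, Finset.mem_coe, hmV]; exact ⟨v.2, hv⟩))
  refine ⟨Nat.card_eq_two_iff.2 ⟨C₁, C₂, hne, hcover⟩, C₁, C₂, hne, ?_, ?_⟩
  · have hS : Subtype.val '' C₁.supp ∪ {x} = ((Finset.univ \ {b, c} : Finset V) : Set V) := by
      rw [hC₁]
      ext v
      by_cases hvx : v = x
      · simp [hvx, hxb, hxc]
      · simp [hvx]
    rw [hS]
    have hx' : x ∈ Finset.univ \ {b, c} := by simp [hxb, hxc]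
    refine Conn.kConnected_two (ht.conn_sdiff (h1.conn_univ h2 x) ⟨x, hx'⟩) ?_
      fun v => h1.conn_sdiff_singleton h2 ht hV he
    have hins : insert x (Finset.univ \ {x, b, c}) = Finset.univ \ {b, c} := by
      ext v
      by_cases hvx : v = x
      · simp [hvx, hxb, hxc]
      · simp [hvx]
    rw [← hins, Finset.card_insert_of_notMem (by simp)]
    by_contra hcard
    have hpos := hV.1.card_pos
    obtain ⟨v, hv⟩ := Finset.card_eq_one.1
      (show (Finset.univ \ {x, b, c} : Finset V).card = 1 by omega)
    rw [hv, edgeCount_singleton] at he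
    exact Nat.not_lt_zero _ he
  · have hS : Subtype.val '' C₂.supp ∪ {x} = (({x, b, c} : Finset V) : Set V) := by
      rw [hC₂]
      ext v
      simp
    rw [hS]
    exact IsNClique.nonempty_iso (is3Clique_triple_iff.2 ⟨ht.1, ht.2.1, ht.2.2.1⟩)
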